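/- arXiv:1710.08714 — 10 statements merged into one kernel-verified Lean document; each statement's English description precedes it below -/
import Mathlib

section
/- Fix K ∈ ℕ. Suppose that for k = 1,…,K the functions a_k : ℝ → ℝ are bounded and measurable, a_0 : ℝ → ℝ is measurable, and w : ℝ → ℝ is bounded. For t ≥ 0 define F_0(t)f(x) = w(t·a_0(x))·f(x), F_k(t) = (A(t^{1/(2k)}) − I)^k ∘ B_{a_k} ∘ (I − A(t^{1/(2k)})*)^k for k = 1,…,K, and S(t) = I + ∑_{k=0}^K F_k(t). Then for every t ≥ 0 the bounded operator S(t) on L²(ℝ) is self-adjoint: S(t)* = S(t). -/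
open MeasureTheory Filter
open scoped ENNReal

noncomputable abbrev H1 : Type := Lp ℂ 2 (volume : Measure ℝ)

theorem mul_selfadjoint_aux (m : ℝ → ℝ) (M : H1 →L[ℂ] H1)
    (hM : ∀ f : H1, ⇑(M f) =ᵐ[volume] fun x => (m x : ℂ) * f x) :
    star M = M := by
  rw [ContinuousLinearMap.star_eq_adjoint]
  symm
  rw [ContinuousLinearMap.eq_adjoint_iff]
  intro f g
  rw [L2.inner_def, L2.inner_def]
  apply integral_congr_ae
  filter_upwards [hM f, hM g] with x hf hg
  rw [hf, hg]
  simp only [RCLike.inner_apply, map_mul, Complex.conj_ofReal]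
  ring

/-- With `S(t) = I + ∑_{k=0}^K F_k(t)` built from translation and multiplication
operators with real-valued bounded `a_k`, `w`, the bounded operator `S(t)` is self-adjoint
for every `t ≥ 0`. -/
theorem statement1
    (K : ℕ)
    (a₀ : ℝ → ℝ) (ha₀ : Measurable a₀)
    (a : ℕ → ℝ → ℝ)
    (ha_meas : ∀ k ∈ Finset.Icc 1 K, Measurable (a k))
    (ha_bdd : ∀ k ∈ Finset.Icc 1 K, BddAbove (Set.range fun x => |a k x|))
    (w : ℝ → ℝ)
    (hw_bdd : BddAbove (Set.range fun x => |w x|))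
    (A : ℝ → (H1 →L[ℂ] H1))
    (hA : ∀ (t : ℝ) (f : H1), ⇑(A t f) =ᵐ[volume] fun x => f (x + t))
    (hAadj : ∀ (t : ℝ) (f : H1),
      ⇑((ContinuousLinearMap.adjoint (A t)) f) =ᵐ[volume] fun x => f (x - t))
    (B : ℕ → (H1 →L[ℂ] H1))
    (hB : ∀ k ∈ Finset.Icc 1 K, ∀ f : H1,
      ⇑(B k f) =ᵐ[volume] fun x => (a k x : ℂ) * f x)
    (F : ℕ → ℝ → (H1 →L[ℂ] H1))
    (hF0 : ∀ (t : ℝ) (f : H1),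
      ⇑(F 0 t f) =ᵐ[volume] fun x => (w (t * a₀ x) : ℂ) * f x)
    (hFk : ∀ k ∈ Finset.Icc 1 K, ∀ t : ℝ,
      F k t = (A (t ^ (1 / (2 * (k : ℝ)))) - 1) ^ k * B k *
        (1 - ContinuousLinearMap.adjoint (A (t ^ (1 / (2 * (k : ℝ)))))) ^ k)
    (S : ℝ → (H1 →L[ℂ] H1))
    (hS : ∀ t : ℝ, S t = 1 + ∑ k ∈ Finset.range (K + 1), F k t) :
    ∀ t : ℝ, 0 ≤ t → ContinuousLinearMap.adjoint (S t) = S t := by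
  intro t _
  rw [← ContinuousLinearMap.star_eq_adjoint, hS, star_add, star_one, star_sum]
  congr 1
  apply Finset.sum_congr rfl
  intro k hk
  rcases Nat.eq_zero_or_pos k with rfl | hpos
  · exact mul_selfadjoint_aux _ _ (hF0 t)
  · have hk' : k ∈ Finset.Icc 1 K := by
      simp only [Finset.mem_range, Finset.mem_Icc] at *
      omega
    rw [hFk k hk' t, ← ContinuousLinearMap.star_eq_adjoint]
    generalize A (t ^ (1 / (2 * (k : ℝ)))) = T
    have hBs := mul_selfadjoint_aux _ _ (hB k hk')
    rw [star_mul, star_mul, star_pow, star_pow, star_sub, star_sub, star_star, star_one, hBs,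
      ← neg_sub T 1, ← neg_sub 1 (star T), neg_pow (T - 1), neg_pow (1 - star T)]
    rcases neg_one_pow_eq_or (H1 →L[ℂ] H1) k with h | h <;> rw [h] <;> simp [mul_assoc]
end

section
/- Fix K ∈ ℕ. Suppose that for k = 1,…,K the functions a_k : ℝ → ℝ are bounded and continuous, a_0 : ℝ → ℝ is measurable, and w : ℝ → ℝ is continuous and bounded. For t ≥ 0 define F_0(t)f(x) = w(t·a_0(x))·f(x), F_k(t) = (A(t^{1/(2k)}) − I)^k ∘ B_{a_k} ∘ (I − A(t^{1/(2k)})*)^k for k = 1,…,K, and S(t) = I + ∑_{k=0}^K F_k(t). Then for every f ∈ L²(ℝ) the map t ↦ S(t)f is continuous from [0,∞) to L²(ℝ) (continuity in the L² norm). -/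
open MeasureTheory Filter
open scoped ENNReal

open Topology in
theorem aux_trans_cont (A : ℝ → (H1 →L[ℂ] H1)) (s : ℝ → ℝ) (hs : Continuous s)
    (hA : ∀ (t : ℝ) (f : H1), ⇑(A t f) =ᵐ[volume] fun x => f (x + s t))
    (g : ℝ → H1) (hg : Continuous g) : Continuous fun t => A t (g t) := by
  haveI : Fact ((2 : ℝ≥0∞) ≠ ∞) := ⟨by norm_num⟩
  have h : ∀ t, A t (g t) = (DomAddAct.mk (s t)) +ᵥ (g t) := by
    intro t
    apply Lp.ext
    refine (hA t (g t)).trans ?_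
    refine EventuallyEq.trans ?_ (DomAddAct.vadd_Lp_ae_eq (DomAddAct.mk (s t)) (g t)).symm
    filter_upwards with x
    simp [add_comm]
  simp_rw [h]
  exact (DomAddAct.continuous_mk.comp hs).vadd hg

theorem aux_pow_cont (T : ℝ → (H1 →L[ℂ] H1))
    (hT : ∀ g : ℝ → H1, Continuous g → Continuous fun t => T t (g t)) (n : ℕ)
    (g : ℝ → H1) (hg : Continuous g) : Continuous fun t => ((T t) ^ n) (g t) := by
  induction n generalizing g with
  | zero => simpa using hg
  | succ n ih =>
    simp_rw [pow_succ, ContinuousLinearMap.mul_apply]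
    exact ih _ (hT g hg)

theorem aux_norm_sq (g : H1) : ‖g‖ ^ 2 = ∫ x, ‖g x‖ ^ 2 := by
  have h := L2.inner_def (𝕜 := ℂ) g g
  rw [inner_self_eq_norm_sq_to_K] at h
  simp_rw [inner_self_eq_norm_sq_to_K] at h
  apply Complex.ofReal_injective
  refine Eq.trans ?_ (integral_ofReal (𝕜 := ℂ) (f := fun x => ‖g x‖ ^ 2))
  simpa using h

theorem aux_mul_cont (a₀ : ℝ → ℝ) (ha₀ : Measurable a₀)
    (w : ℝ → ℝ) (hw_cont : Continuous w)
    (hw_bdd : BddAbove (Set.range fun x => |w x|))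
    (F : ℝ → (H1 →L[ℂ] H1))
    (hF0 : ∀ (t : ℝ) (f : H1),
      ⇑(F t f) =ᵐ[volume] fun x => (w (t * a₀ x) : ℂ) * f x) (f : H1) :
    Continuous fun t => F t f := by
  obtain ⟨C, hC⟩ := hw_bdd
  have hC' : ∀ x, |w x| ≤ C := fun x => hC ⟨x, rfl⟩
  have hfint : Integrable (fun x => ‖f x‖ ^ 2) volume :=
    (memLp_two_iff_integrable_sq_norm (Lp.aestronglyMeasurable f)).1 (Lp.memLp f)
  rw [continuous_iff_continuousAt]
  intro t₀
  have key : ∀ t, ‖F t f - F t₀ f‖ ^ 2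
      = ∫ x, ((w (t * a₀ x) - w (t₀ * a₀ x)) ^ 2 * ‖f x‖ ^ 2) := by
    intro t
    rw [aux_norm_sq]
    apply integral_congr_ae
    filter_upwards [Lp.coeFn_sub (F t f) (F t₀ f), hF0 t f, hF0 t₀ f] with x h1 h2 h3
    rw [h1, Pi.sub_apply, h2, h3, ← sub_mul, norm_mul, mul_pow, ← Complex.ofReal_sub,
      Complex.norm_real, Real.norm_eq_abs, sq_abs]
  have hcont : Continuous fun t => ∫ x, ((w (t * a₀ x) - w (t₀ * a₀ x)) ^ 2 * ‖f x‖ ^ 2) := by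
    refine continuous_of_dominated (bound := fun x => (2 * C) ^ 2 * ‖f x‖ ^ 2) ?_ ?_ ?_ ?_
    · intro t
      refine AEStronglyMeasurable.mul ?_ hfint.1
      have hm : ∀ t : ℝ, Measurable fun x => w (t * a₀ x) := fun t =>
        hw_cont.measurable.comp (ha₀.const_mul t)
      exact (((hm t).sub (hm t₀)).pow_const 2).aestronglyMeasurable
    · intro t
      filter_upwards with x
      rw [Real.norm_of_nonneg (by positivity)]
      have h1 := abs_le.1 (hC' (t * a₀ x))
      have h2 := abs_le.1 (hC' (t₀ * a₀ x))
      refine mul_le_mul_of_nonneg_right ?_ (by positivity)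
      apply sq_le_sq'
      · linarith
      · linarith
    · exact hfint.const_mul _
    · filter_upwards with x
      fun_prop
  have h0 : Tendsto (fun t => ‖F t f - F t₀ f‖ ^ 2) (nhds t₀) (nhds 0) := by
    simp_rw [key]
    have := hcont.tendsto t₀
    simpa using this
  have h1 : Tendsto (fun t => ‖F t f - F t₀ f‖) (nhds t₀) (nhds 0) := by
    have := (Real.continuous_sqrt.tendsto 0).comp h0
    simpa [Function.comp_def] using this
  exact tendsto_iff_norm_sub_tendsto_zero.2 h1

/-- With `a_k` bounded continuous, `w` continuous bounded, and
`S(t) = I + ∑_{k=0}^K F_k(t)` as in the paper, for every `f ∈ L²(ℝ)` the map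
`t ↦ S(t)f` is continuous from `[0,∞)` to `L²(ℝ)`. -/
theorem statement3
    (K : ℕ)
    (a₀ : ℝ → ℝ) (ha₀ : Measurable a₀)
    (a : ℕ → ℝ → ℝ)
    (ha_cont : ∀ k ∈ Finset.Icc 1 K, Continuous (a k))
    (ha_bdd : ∀ k ∈ Finset.Icc 1 K, BddAbove (Set.range fun x => |a k x|))
    (w : ℝ → ℝ) (hw_cont : Continuous w)
    (hw_bdd : BddAbove (Set.range fun x => |w x|))
    (A : ℝ → (H1 →L[ℂ] H1))
    (hA : ∀ (t : ℝ) (f : H1), ⇑(A t f) =ᵐ[volume] fun x => f (x + t))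
    (hAadj : ∀ (t : ℝ) (f : H1),
      ⇑((ContinuousLinearMap.adjoint (A t)) f) =ᵐ[volume] fun x => f (x - t))
    (B : ℕ → (H1 →L[ℂ] H1))
    (hB : ∀ k ∈ Finset.Icc 1 K, ∀ f : H1,
      ⇑(B k f) =ᵐ[volume] fun x => (a k x : ℂ) * f x)
    (F : ℕ → ℝ → (H1 →L[ℂ] H1))
    (hF0 : ∀ (t : ℝ) (f : H1),
      ⇑(F 0 t f) =ᵐ[volume] fun x => (w (t * a₀ x) : ℂ) * f x)
    (hFk : ∀ k ∈ Finset.Icc 1 K, ∀ t : ℝ,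
      F k t = (A (t ^ (1 / (2 * (k : ℝ)))) - 1) ^ k * B k *
        (1 - ContinuousLinearMap.adjoint (A (t ^ (1 / (2 * (k : ℝ)))))) ^ k)
    (S : ℝ → (H1 →L[ℂ] H1))
    (hS : ∀ t : ℝ, S t = 1 + ∑ k ∈ Finset.range (K + 1), F k t) :
    ∀ f : H1, ContinuousOn (fun t : ℝ => S t f) (Set.Ici 0) := by
  intro f
  apply Continuous.continuousOn
  simp_rw [hS]
  simp only [ContinuousLinearMap.add_apply, ContinuousLinearMap.sum_apply,
    ContinuousLinearMap.one_apply]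
  refine continuous_const.add (continuous_finsetSum _ fun k hk => ?_)
  rcases Nat.eq_zero_or_pos k with rfl | hkpos
  · exact aux_mul_cont a₀ ha₀ w hw_cont hw_bdd (F 0) hF0 f
  have hk' : k ∈ Finset.Icc 1 K := by
    rw [Finset.mem_range] at hk
    rw [Finset.mem_Icc]
    omega
  have hs : Continuous fun t : ℝ => t ^ (1 / (2 * (k : ℝ))) :=
    Real.continuous_rpow_const (by positivity)
  simp_rw [hFk k hk', ContinuousLinearMap.mul_apply]
  refine aux_pow_cont (fun t => A (t ^ (1 / (2 * (k : ℝ)))) - 1) ?_ k _ ?_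
  · intro g hg
    simp only [ContinuousLinearMap.sub_apply, ContinuousLinearMap.one_apply]
    exact (aux_trans_cont (fun t => A (t ^ (1 / (2 * (k : ℝ))))) _ hs (fun t f => hA _ f) g hg).sub hg
  · refine (B k).continuous.comp ?_
    refine aux_pow_cont
      (fun t => 1 - ContinuousLinearMap.adjoint (A (t ^ (1 / (2 * (k : ℝ)))))) ?_ k _ continuous_const
    intro g hg
    simp only [ContinuousLinearMap.sub_apply, ContinuousLinearMap.one_apply]
    refine hg.sub (aux_trans_cont
      (fun t => ContinuousLinearMap.adjoint (A (t ^ (1 / (2 * (k : ℝ)))))) _ hs.neg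
      (fun t f => ?_) g hg)
    simpa only [sub_eq_add_neg, Pi.neg_apply] using hAadj (t ^ (1 / (2 * (k : ℝ)))) f
end

section
/- Let k ∈ ℕ and let f : ℝ → ℝ be a C^{k+1} function with compact support contained in the interval [a,b]. Then for every τ ∈ ℝ the L²-norm of the Taylor remainder satisfies ‖x ↦ f(x+τ) − ∑_{j=0}^{k} (τ^j / j!)·f^{(j)}(x)‖_{L²(ℝ)} ≤ |τ|^{k+1} · (b − a + 2|τ|)^{1/2} · sup_{z∈ℝ}|f^{(k+1)}(z)| / (k+1)!. -/
open MeasureTheory Filter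
open scoped ENNReal

theorem aux_taylor (k : ℕ) (f : ℝ → ℝ) (hf : ContDiff ℝ (k + 1 : ℕ) f) (x τ : ℝ) :
    ∃ z, f (x + τ) - ∑ j ∈ Finset.range (k + 1),
      τ ^ j / (Nat.factorial j : ℝ) * iteratedDeriv j f x =
      iteratedDeriv (k + 1) f z * τ ^ (k + 1) / (Nat.factorial (k + 1) : ℝ) := by
  by_cases h0 : τ = 0
  · subst h0
    refine ⟨x, ?_⟩
    rw [Finset.sum_range_succ']
    simp
  have hx : x ≠ x + τ := by simpa using h0
  have hu : UniqueDiffOn ℝ (Set.uIcc x (x + τ)) := uniqueDiffOn_uIcc hx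
  have he : ∀ j ≤ k + 1, ∀ y ∈ Set.uIcc x (x + τ),
      iteratedDerivWithin j f (Set.uIcc x (x + τ)) y = iteratedDeriv j f y := by
    intro j hj y hy
    exact iteratedDerivWithin_eq_iteratedDeriv hu
      ((hf.of_le (by exact_mod_cast hj)).contDiffAt) hy
  obtain ⟨z, hz, h⟩ := taylor_mean_remainder_lagrange (n := k) hx
    ((hf.of_le (by exact_mod_cast Nat.le_succ k)).contDiffOn)
    (((hf.contDiffOn).differentiableOn_iteratedDerivWithin
      (by exact_mod_cast Nat.lt_succ_self k) hu).mono Set.uIoo_subset_uIcc_self)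
  refine ⟨z, ?_⟩
  rw [he _ le_rfl z (Set.uIoo_subset_uIcc_self hz), taylor_within_apply, add_sub_cancel_left] at h
  rw [← h]
  congr 1
  refine Finset.sum_congr rfl fun j hj => ?_
  rw [he j (by have := Finset.mem_range.1 hj; omega) x Set.left_mem_uIcc, smul_eq_mul]
  ring

theorem aux_zero (f : ℝ → ℝ) (a b : ℝ) (hsupp : ∀ x : ℝ, x ∉ Set.Icc a b → f x = 0)
    (j : ℕ) (x : ℝ) (hx : x ∉ Set.Icc a b) : iteratedDeriv j f x = 0 := by
  have h : f =ᶠ[nhds x] fun _ => (0 : ℝ) := by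
    filter_upwards [isClosed_Icc.isOpen_compl.mem_nhds hx] with y hy using hsupp y hy
  rw [h.iteratedDeriv_eq j]
  simp

/-- For a `C^{k+1}` function `f : ℝ → ℝ` with support contained in `[a,b]`,
the L²-norm of the Taylor remainder `f(·+τ) − ∑_{j=0}^k (τ^j/j!) f^{(j)}` is at most
`|τ|^{k+1} (b − a + 2|τ|)^{1/2} sup_z |f^{(k+1)}(z)| / (k+1)!`. -/
theorem statement5
    (k : ℕ) (f : ℝ → ℝ)
    (hf : ContDiff ℝ (k + 1 : ℕ) f)
    (a b : ℝ) (hab : a ≤ b)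
    (hsupp : ∀ x : ℝ, x ∉ Set.Icc a b → f x = 0) :
    ∀ τ : ℝ,
      eLpNorm
          (fun x : ℝ =>
            f (x + τ) - ∑ j ∈ Finset.range (k + 1),
              τ ^ j / (Nat.factorial j : ℝ) * iteratedDeriv j f x)
          2 volume ≤
        ENNReal.ofReal
          (|τ| ^ (k + 1) * Real.sqrt (b - a + 2 * |τ|) *
            (⨆ z : ℝ, |iteratedDeriv (k + 1) f z|) / (Nat.factorial (k + 1) : ℝ)) := by
  intro τ
  have hbdd : BddAbove (Set.range fun z => |iteratedDeriv (k + 1) f z|) := by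
    have hc : Continuous (fun z => |iteratedDeriv (k + 1) f z|) :=
      (hf.continuous_iteratedDeriv (k + 1) le_rfl).abs
    refine hc.bddAbove_range_of_hasCompactSupport ?_
    refine HasCompactSupport.intro (isCompact_Icc (a := a) (b := b)) fun x hx => ?_
    rw [aux_zero f a b hsupp _ x hx, abs_zero]
  set M := ⨆ z : ℝ, |iteratedDeriv (k + 1) f z| with hM
  rw [← eLpNorm_restrict_eq_of_support_subset (s := Set.Icc (a - |τ|) (b + |τ|))]
  · have hL : 0 ≤ b - a + 2 * |τ| := by have := abs_nonneg τ; linarith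
    refine (eLpNorm_le_of_ae_bound
      (C := M * |τ| ^ (k + 1) / (Nat.factorial (k + 1) : ℝ)) ?_).trans ?_
    · refine Eventually.of_forall fun x => ?_
      obtain ⟨z, hz⟩ := aux_taylor k f hf x τ
      rw [hz, Real.norm_eq_abs, abs_div, abs_mul, abs_pow, Nat.abs_cast]
      gcongr
      exact le_ciSup hbdd z
    · rw [Measure.restrict_apply_univ, Real.volume_Icc,
        show b + |τ| - (a - |τ|) = b - a + 2 * |τ| by ring,
        ENNReal.ofReal_rpow_of_nonneg hL (by positivity),
        ← ENNReal.ofReal_mul (by positivity), Real.sqrt_eq_rpow]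
      apply le_of_eq
      congr 1
      norm_num
      ring
  · intro x hx
    by_contra hn
    apply hx
    have h1 : x ∉ Set.Icc a b := fun h => hn
      ⟨by have := abs_nonneg τ; linarith [h.1], by have := abs_nonneg τ; linarith [h.2]⟩
    have h2 : x + τ ∉ Set.Icc a b := fun h => hn
      ⟨by have := le_abs_self τ; linarith [h.1], by have := neg_abs_le τ; linarith [h.2]⟩
    simp only
    rw [hsupp _ h2, Finset.sum_eq_zero, sub_zero]
    intro j _
    rw [aux_zero f a b hsupp j x h1, mul_zero]
end

section
/- Let k ≥ 1 be an integer and let f : ℝ → ℝ be a compactly supported C^{2k} function (all derivatives of f up to order 2k are bounded). Then (A(τ) − I)^k f = τ^k·f^{(k)} + o(τ^k) in L²(ℝ) as τ → 0; explicitly, lim_{τ→0} |τ|^{−k} · ‖(A(τ) − I)^k f − τ^k·f^{(k)}‖_{L²(ℝ)} = 0. -/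
open MeasureTheory Filter
open scoped ENNReal Topology

/-- Two-sided mean value theorem. -/
theorem aux_mvt (g : ℝ → ℝ) (hg : Differentiable ℝ g) (y τ : ℝ) :
    ∃ z, |z - y| ≤ |τ| ∧ g (y + τ) - g y = τ * deriv g z := by
  rcases lt_trichotomy τ 0 with h | h | h
  · obtain ⟨c, hc, e⟩ := exists_deriv_eq_slope g (a := y + τ) (b := y) (by linarith)
      hg.continuous.continuousOn hg.differentiableOn
    refine ⟨c, ?_, ?_⟩
    · rw [abs_of_neg h, abs_le]
      constructor <;> linarith [hc.1, hc.2]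
    · rw [e]
      have : y - (y + τ) ≠ 0 := by intro h'; linarith
      have h2 := h.ne
      field_simp
      ring
  · subst h
    exact ⟨y, by simp, by simp⟩
  · obtain ⟨c, hc, e⟩ := exists_deriv_eq_slope g (a := y) (b := y + τ) (by linarith)
      hg.continuous.continuousOn hg.differentiableOn
    refine ⟨c, ?_, ?_⟩
    · rw [abs_of_pos h, abs_le]
      constructor <;> linarith [hc.1, hc.2]
    · rw [e, add_sub_cancel_left]
      have h2 := h.ne'
      field_simp

/-- Mean value theorem for iterated forward differences. -/
theorem aux_fwdDiff (τ : ℝ) (n : ℕ) : ∀ (g : ℝ → ℝ), ContDiff ℝ n g → ∀ x : ℝ,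
    ∃ y, |y - x| ≤ n * |τ| ∧ (fwdDiff τ)^[n] g x = τ ^ n * iteratedDeriv n g y := by
  induction n with
  | zero => intro g _ x; exact ⟨x, by simp, by simp⟩
  | succ n ih =>
    intro g hg x
    have hgn : ContDiff ℝ n g := hg.of_le (by exact_mod_cast Nat.le_succ n)
    have hsh : ContDiff ℝ n (fun z => g (z + τ)) := hgn.comp (contDiff_id.add contDiff_const)
    obtain ⟨y, hy, e⟩ := ih (fwdDiff τ g) (hsh.sub hgn) x
    have e2 : iteratedDeriv n (fwdDiff τ g) y
        = iteratedDeriv n g (y + τ) - iteratedDeriv n g y := by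
      unfold fwdDiff
      rw [iteratedDeriv_fun_sub hsh.contDiffAt hgn.contDiffAt, iteratedDeriv_comp_add_const]
    obtain ⟨z, hz, e3⟩ := aux_mvt (iteratedDeriv n g)
      (hg.differentiable_iteratedDeriv n (by exact_mod_cast Nat.lt_succ_self n)) y τ
    refine ⟨z, ?_, ?_⟩
    · have := abs_sub_le z y x
      push_cast
      linarith
    · rw [Function.iterate_succ_apply, e, e2, e3, iteratedDeriv_succ]
      ring

/-- For `k ≥ 1` and a compactly supported `C^{2k}` function `f : ℝ → ℝ`,
`(A(τ) − I)^k f = τ^k f^{(k)} + o(τ^k)` in `L²(ℝ)` as `τ → 0`; here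
`((A(τ) − I)^k f)(x) = ∑_{j=0}^k C(k,j) (−1)^{k−j} f(x + jτ)`. -/
theorem statement6
    (k : ℕ) (hk : 1 ≤ k)
    (f : ℝ → ℝ)
    (hf : ContDiff ℝ (2 * k : ℕ) f)
    (hfc : HasCompactSupport f) :
    Filter.Tendsto
      (fun τ : ℝ =>
        (|τ| ^ k)⁻¹ *
          (eLpNorm
              (fun x : ℝ =>
                (∑ j ∈ Finset.range (k + 1),
                  (k.choose j : ℝ) * (-1) ^ (k - j) * f (x + (j : ℝ) * τ)) -
                  τ ^ k * iteratedDeriv k f x)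
              2 volume).toReal)
      (𝓝[≠] (0 : ℝ)) (𝓝 0) := by
  have hfk : ContDiff ℝ k f := hf.of_le (by exact_mod_cast (by omega : k ≤ 2 * k))
  have hsum : ∀ τ x : ℝ, (∑ j ∈ Finset.range (k + 1),
      (k.choose j : ℝ) * (-1) ^ (k - j) * f (x + (j : ℝ) * τ)) = (fwdDiff τ)^[k] f x := by
    intro τ x
    rw [fwdDiff_iter_eq_sum_shift]
    refine Finset.sum_congr rfl fun j _ => ?_
    simp only [zsmul_eq_mul, nsmul_eq_mul]
    push_cast
    ring
  obtain ⟨R, hR⟩ := hfc.isCompact.isBounded.subset_closedBall (0 : ℝ)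
  have hf0 : ∀ x, R < |x| → f x = 0 := by
    intro x hx
    by_contra h
    have := hR (subset_tsupport f h)
    rw [mem_closedBall_zero_iff, Real.norm_eq_abs] at this
    linarith
  have htd : tsupport (iteratedDeriv k f) ⊆ tsupport f := by
    refine closure_minimal ?_ (isClosed_tsupport f)
    intro x hx
    refine support_iteratedFDeriv_subset (𝕜 := ℝ) k ?_
    intro h
    apply hx
    rw [iteratedDeriv_eq_iteratedFDeriv, h]
    rfl
  have hd0 : ∀ x, R < |x| → iteratedDeriv k f x = 0 := by
    intro x hx
    by_contra h
    have := hR (htd (subset_tsupport _ h))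
    rw [mem_closedBall_zero_iff, Real.norm_eq_abs] at this
    linarith
  have hdc : HasCompactSupport (iteratedDeriv k f) :=
    hfc.of_isClosed_subset (isClosed_tsupport _) htd
  have huc : UniformContinuous (iteratedDeriv k f) :=
    hdc.uniformContinuous_of_continuous (hfk.continuous_iteratedDeriv k le_rfl)
  set S : Set ℝ := Metric.closedBall 0 (R + 1) with hS
  set M : ℝ≥0∞ := (volume S) ^ ((2 : ℝ≥0∞).toReal⁻¹) with hM
  have hMfin : M ≠ ∞ := by
    refine ENNReal.rpow_ne_top_of_nonneg (by positivity) ?_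
    exact measure_closedBall_lt_top.ne
  rw [Metric.tendsto_nhds]
  intro ε hε
  have hM0 : 0 ≤ M.toReal := ENNReal.toReal_nonneg
  set η : ℝ := ε / (M.toReal + 1) with hη
  have hηpos : 0 < η := by positivity
  obtain ⟨δ, hδ, huc'⟩ := Metric.uniformContinuous_iff.1 huc η hηpos
  have hk0 : (0 : ℝ) < k := by exact_mod_cast hk
  have hnear : ∀ᶠ τ : ℝ in 𝓝[≠] 0, |τ| < min δ 1 / k := by
    refine mem_nhdsWithin_of_mem_nhds ?_
    have := Metric.ball_mem_nhds (0 : ℝ) (show 0 < min δ 1 / k by positivity)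
    filter_upwards [this] with τ hτ
    simpa using hτ
  filter_upwards [hnear, self_mem_nhdsWithin] with τ hτ hτ0
  have hτ0 : τ ≠ 0 := hτ0
  have hkτ : k * |τ| < min δ 1 := by
    rw [lt_div_iff₀ hk0] at hτ
    linarith
  have hkδ := hkτ.trans_le (min_le_left _ _)
  have hk1 := hkτ.trans_le (min_le_right _ _)
  set F : ℝ → ℝ := (fun x : ℝ =>
                (∑ j ∈ Finset.range (k + 1),
                  (k.choose j : ℝ) * (-1) ^ (k - j) * f (x + (j : ℝ) * τ)) -
                  τ ^ k * iteratedDeriv k f x) with hF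
  have hb : ∀ x, ‖F x‖ ≤ |τ| ^ k * η := by
    intro x
    obtain ⟨y, hy, e⟩ := aux_fwdDiff τ k f hfk x
    simp only [hF]
    rw [hsum, e, ← mul_sub, norm_mul, norm_pow, Real.norm_eq_abs τ]
    refine mul_le_mul_of_nonneg_left ?_ (by positivity)
    have := huc' (a := y) (b := x) (by rw [Real.dist_eq]; linarith)
    rw [dist_eq_norm] at this
    exact this.le
  have hsupp : Function.support F ⊆ S := by
    intro x hx
    by_contra hxS
    rw [hS, mem_closedBall_zero_iff, Real.norm_eq_abs, not_le] at hxS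
    apply hx
    simp only [hF]
    rw [hd0 x (by linarith), Finset.sum_eq_zero, mul_zero, sub_zero]
    intro j hj
    rw [hf0, mul_zero]
    have hj' : (j : ℝ) ≤ k := by exact_mod_cast Nat.lt_succ_iff.1 (Finset.mem_range.1 hj)
    have h1 : |(j : ℝ) * τ| ≤ k * |τ| := by
      rw [abs_mul, Nat.abs_cast]
      gcongr
    have h2 := abs_sub_abs_le_abs_sub x (-((j : ℝ) * τ))
    rw [abs_neg, sub_neg_eq_add] at h2
    linarith
  have hL : eLpNorm F 2 volume ≤ M * ENNReal.ofReal (|τ| ^ k * η) := by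
    rw [← eLpNorm_restrict_eq_of_support_subset hsupp]
    have := eLpNorm_le_of_ae_bound (p := 2) (μ := volume.restrict S) (f := F)
      (Eventually.of_forall hb)
    rwa [Measure.restrict_apply_univ] at this
  have hL' : (eLpNorm F 2 volume).toReal ≤ M.toReal * (|τ| ^ k * η) := by
    have := ENNReal.toReal_mono (ENNReal.mul_ne_top hMfin ENNReal.ofReal_ne_top) hL
    rwa [ENNReal.toReal_mul, ENNReal.toReal_ofReal (by positivity)] at this
  have hp : 0 < |τ| ^ k := by positivity
  rw [Real.dist_eq, sub_zero, abs_of_nonneg (by positivity)]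
  calc (|τ| ^ k)⁻¹ * (eLpNorm F 2 volume).toReal
      ≤ (|τ| ^ k)⁻¹ * (M.toReal * (|τ| ^ k * η)) := by gcongr
    _ = M.toReal * η := by field_simp
    _ < (M.toReal + 1) * η := by linarith
    _ = ε := by rw [hη]; field_simp
end

section
/- Let k ≥ 1 and m ≥ 0 be integers, let a : ℝ → ℝ be bounded with bounded derivatives up to order 2k (a ∈ C_b^{2k}(ℝ)), and let φ ∈ C_c^∞(ℝ). Then (A(τ) − I)^k B_a (I − A(τ)*)^m φ = τ^{k+m} · (d^k/dx^k)(a·φ^{(m)}) + o(τ^{k+m}) in L²(ℝ) as τ → 0; explicitly, lim_{τ→0} |τ|^{−(k+m)} · ‖(A(τ) − I)^k B_a (I − A(τ)*)^m φ − τ^{k+m}·(d^k/dx^k)(x ↦ a(x)·φ^{(m)}(x))‖_{L²(ℝ)} = 0. -/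
open MeasureTheory Filter
open scoped ENNReal Topology

/-- generalized difference operator -/
def FD (p q : ℝ) (g : ℝ → ℝ) : ℝ → ℝ := fun x => g (x + p) - g (x + q)

lemma FD_contDiff {n : WithTop ℕ∞} (p q : ℝ) {g : ℝ → ℝ} (hg : ContDiff ℝ n g) :
    ContDiff ℝ n (FD p q g) := by
  unfold FD
  fun_prop

lemma FD_iter_contDiff {n : WithTop ℕ∞} (p q : ℝ) (m : ℕ) {g : ℝ → ℝ} (hg : ContDiff ℝ n g) :
    ContDiff ℝ n ((FD p q)^[m] g) := by
  induction m with
  | zero => exact hg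
  | succ m ih => rw [Function.iterate_succ_apply']; exact FD_contDiff p q ih

lemma iteratedDeriv_FD (p q : ℝ) (j : ℕ) {g : ℝ → ℝ} (hg : ContDiff ℝ j g) :
    iteratedDeriv j (FD p q g) = FD p q (iteratedDeriv j g) := by
  ext x
  unfold FD
  rw [iteratedDeriv_fun_sub (by fun_prop) (by fun_prop), iteratedDeriv_comp_add_const,
    iteratedDeriv_comp_add_const]

lemma iteratedDeriv_FD_iter (p q : ℝ) (j m : ℕ) {g : ℝ → ℝ} (hg : ContDiff ℝ j g) :
    iteratedDeriv j ((FD p q)^[m] g) = (FD p q)^[m] (iteratedDeriv j g) := by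
  induction m with
  | zero => rfl
  | succ m ih =>
    rw [Function.iterate_succ_apply', Function.iterate_succ_apply',
      iteratedDeriv_FD p q j (FD_iter_contDiff p q m hg), ih]

lemma FD_key (p q δ : ℝ) (hp : |p| ≤ δ) (hq : |q| ≤ δ) (k : ℕ) :
    ∀ (g : ℝ → ℝ), ContDiff ℝ k g → ∀ (x c ε : ℝ),
    (∀ y, |y - x| ≤ k * δ → |iteratedDeriv k g y - c| ≤ ε) →
    |(FD p q)^[k] g x - (p - q) ^ k * c| ≤ |p - q| ^ k * ε := by
  induction k with
  | zero =>
    intro g hg x c ε h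
    simpa using h x (by simp)
  | succ k ih =>
    intro g hg x c ε h
    rw [Function.iterate_succ_apply]
    have hgk : ContDiff ℝ k g := hg.of_le (by exact_mod_cast Nat.le_succ k)
    have := ih (FD p q g) (FD_contDiff p q hgk) x
      ((p - q) * c) (|p - q| * ε) ?_
    · calc _ = |(FD p q)^[k] (FD p q g) x - (p - q) ^ k * ((p - q) * c)| := by ring_nf
        _ ≤ _ := this
        _ = _ := by ring
    intro y hy
    rw [iteratedDeriv_FD p q k hgk]
    have hd : ∀ z ∈ Metric.closedBall y δ, HasDerivWithinAt (fun z => iteratedDeriv k g z - c * z)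
        (iteratedDeriv (k+1) g z - c) (Metric.closedBall y δ) z := by
      intro z _
      apply HasDerivAt.hasDerivWithinAt
      have h1 : HasDerivAt (iteratedDeriv k g) (iteratedDeriv (k+1) g z) z := by
        rw [iteratedDeriv_succ]
        exact (hg.differentiable_iteratedDeriv k (by exact_mod_cast Nat.lt_succ_self k) z).hasDerivAt
      simpa using h1.fun_sub ((hasDerivAt_id z).const_mul c)
    have hb : ∀ z ∈ Metric.closedBall y δ, ‖iteratedDeriv (k+1) g z - c‖ ≤ ε := by
      intro z hz
      apply h
      rw [Metric.mem_closedBall, Real.dist_eq] at hz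
      calc |z - x| ≤ |z - y| + |y - x| := abs_sub_le _ _ _
        _ ≤ δ + k * δ := add_le_add hz hy
        _ = _ := by push_cast; ring
    have := Convex.norm_image_sub_le_of_norm_hasDerivWithin_le (x := y + q) (y := y + p) hd hb
      (convex_closedBall _ _) (by simpa [Real.dist_eq] using hq) (by simpa [Real.dist_eq] using hp)
    simp only [Real.norm_eq_abs] at this
    unfold FD
    calc _ = |iteratedDeriv k g (y + p) - c * (y + p) - (iteratedDeriv k g (y + q) - c * (y + q))| := by
          ring_nf
      _ ≤ _ := this
      _ = _ := by rw [mul_comm]; ring_nf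

lemma iteratedDeriv_iteratedDeriv_aux (i j : ℕ) (g : ℝ → ℝ) :
    iteratedDeriv i (iteratedDeriv j g) = iteratedDeriv (i + j) g := by
  simp only [iteratedDeriv_eq_iterate, Function.iterate_add_apply]

lemma tsupport_iteratedDeriv_aux (n : ℕ) (g : ℝ → ℝ) :
    tsupport (iteratedDeriv n g) ⊆ tsupport g := by
  induction n with
  | zero => simp
  | succ n ih =>
    rw [iteratedDeriv_succ]
    exact (closure_minimal (support_deriv_subset) (isClosed_tsupport _)).trans ih

lemma smooth_iteratedDeriv_aux (n : ℕ) (g : ℝ → ℝ) (hg : ContDiff ℝ (⊤ : ℕ∞) g) :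
    ContDiff ℝ (⊤ : ℕ∞) (iteratedDeriv n g) := by
  rw [iteratedDeriv_eq_iterate]
  exact hg.iterate_deriv n

lemma iteratedDeriv_ofReal_aux (n : ℕ) (g : ℝ → ℝ) (hg : ContDiff ℝ n g) :
    iteratedDeriv n (fun x => (g x : ℂ)) = fun x => ((iteratedDeriv n g x : ℝ) : ℂ) := by
  induction n with
  | zero => simp
  | succ n ih =>
    rw [iteratedDeriv_succ, ih (hg.of_le (by exact_mod_cast Nat.le_succ n)), iteratedDeriv_succ]
    ext x
    exact ((hg.differentiable_iteratedDeriv n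
      (by exact_mod_cast Nat.lt_succ_self n) x).hasDerivAt.ofReal_comp).deriv

lemma unif_aux (g : ℝ → ℝ) (hc : Continuous g) (hs : HasCompactSupport g) (ε : ℝ) (hε : 0 < ε) :
    ∃ δ > 0, ∀ x y, |y - x| < δ → |g y - g x| < ε := by
  have := hc.uniformContinuous_of_tendsto_cocompact (x := 0) hs.is_zero_at_infty
  obtain ⟨δ, h1, h2⟩ := Metric.uniformContinuous_iff.1 this ε hε
  exact ⟨δ, h1, fun x y h => by simpa [Real.dist_eq] using h2 (a := y) (b := x) (by simpa [Real.dist_eq] using h)⟩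

lemma bd_unif (φ : ℝ → ℝ) (hφ : ContDiff ℝ (⊤ : ℕ∞) φ) (hφc : HasCompactSupport φ) (m j : ℕ)
    (ε : ℝ) (hε : 0 < ε) :
    ∀ᶠ τ in 𝓝 (0:ℝ), ∀ x, |iteratedDeriv j (fun y => (FD 0 (-τ))^[m] φ y - τ ^ m * iteratedDeriv m φ y) x|
      ≤ |τ| ^ m * ε := by
  have hs : HasCompactSupport (iteratedDeriv (m + j) φ) :=
    hφc.of_isClosed_subset (isClosed_tsupport _) (tsupport_iteratedDeriv_aux _ _)
  obtain ⟨δ, hδ, h⟩ := unif_aux _ (smooth_iteratedDeriv_aux (m+j) φ hφ).continuous hs ε hε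
  have : ∀ᶠ τ in 𝓝 (0:ℝ), |τ| < δ / (m + 1) := by
    have : Tendsto (fun τ : ℝ => |τ|) (𝓝 0) (𝓝 0) := by simpa using (continuous_abs.tendsto (0:ℝ))
    exact this.eventually_lt_const (by positivity)
  filter_upwards [this] with τ hτ x
  have hj : ∀ n : ℕ, ContDiff ℝ n φ := fun n => hφ.of_le (by exact_mod_cast le_top)
  have hj' : ∀ n i : ℕ, ContDiff ℝ n (iteratedDeriv i φ) :=
    fun n i => (smooth_iteratedDeriv_aux i φ hφ).of_le (by exact_mod_cast le_top)
  rw [iteratedDeriv_fun_sub (FD_iter_contDiff _ _ _ (hj j)).contDiffAt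
      (contDiff_const.mul (hj' j m)).contDiffAt,
    iteratedDeriv_const_mul _ (hj' j m).contDiffAt, iteratedDeriv_FD_iter _ _ _ _ (hj j),
    iteratedDeriv_iteratedDeriv_aux]
  have := FD_key 0 (-τ) |τ| (by simp) (by simp) m (iteratedDeriv j φ) (hj' m j) x
    (iteratedDeriv (m + j) φ x) ε ?_
  · simpa [add_comm] using this
  intro y hy
  rw [iteratedDeriv_iteratedDeriv_aux]
  refine (h x y (hy.trans_lt ?_)).le
  rw [lt_div_iff₀ (by positivity)] at hτ
  nlinarith [abs_nonneg τ]

lemma prod_unif (k m : ℕ) (a : ℝ → ℝ) (ha : ContDiff ℝ k a)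
    (ha_bdd : ∀ i ≤ k, ∃ C : ℝ, ∀ x : ℝ, |iteratedDeriv i a x| ≤ C)
    (φ : ℝ → ℝ) (hφ : ContDiff ℝ (⊤ : ℕ∞) φ) (hφc : HasCompactSupport φ)
    (ε : ℝ) (hε : 0 < ε) :
    ∀ᶠ τ in 𝓝 (0:ℝ), ∀ x, |iteratedDeriv k (fun y => a y *
        ((FD 0 (-τ))^[m] φ y - τ ^ m * iteratedDeriv m φ y)) x| ≤ |τ| ^ m * ε := by
  have : ∃ C : ℝ, 0 < C ∧ ∀ i ≤ k, ∀ x, |iteratedDeriv i a x| ≤ C := by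
    choose! C hC using ha_bdd
    refine ⟨∑ i ∈ Finset.range (k+1), |C i| + 1, by positivity, fun i hi x => ?_⟩
    have := Finset.single_le_sum (f := fun i => |C i|) (s := Finset.range (k+1))
      (fun _ _ => abs_nonneg _) (Finset.mem_range.2 (Nat.lt_succ_of_le hi))
    have h2 := hC i hi x
    have h3 := le_abs_self (C i)
    linarith
  obtain ⟨C, hC0, hC⟩ := this
  have hev : ∀ᶠ τ in 𝓝 (0:ℝ), ∀ j ∈ Finset.range (k+1), ∀ x,
      |iteratedDeriv j (fun y => (FD 0 (-τ))^[m] φ y - τ ^ m * iteratedDeriv m φ y) x|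
      ≤ |τ| ^ m * (ε / (2 ^ k * C)) := by
    rw [Filter.eventually_all_finset]
    exact fun j _ => bd_unif φ hφ hφc m j _ (by positivity)
  filter_upwards [hev] with τ hτ x
  have hj : ∀ n : ℕ, ContDiff ℝ n φ := fun n => hφ.of_le (by exact_mod_cast le_top)
  have hj' : ∀ n i : ℕ, ContDiff ℝ n (iteratedDeriv i φ) :=
    fun n i => (smooth_iteratedDeriv_aux i φ hφ).of_le (by exact_mod_cast le_top)
  rw [iteratedDeriv_fun_mul ha.contDiffAt ((FD_iter_contDiff _ _ _ (hj k)).sub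
      (contDiff_const.mul (hj' k m))).contDiffAt]
  calc _ ≤ ∑ i ∈ Finset.range (k + 1), (k.choose i : ℝ) * (C * (|τ| ^ m * (ε / (2 ^ k * C)))) := by
        refine (Finset.abs_sum_le_sum_abs _ _).trans (Finset.sum_le_sum fun i hi => ?_)
        rw [abs_mul, abs_mul, Nat.abs_cast, mul_assoc]
        have hi' := Finset.mem_range.1 hi
        gcongr
        · exact hC i (by omega) x
        · exact hτ (k - i) (Finset.mem_range.2 (by omega)) x
    _ = 2 ^ k * (C * (|τ| ^ m * (ε / (2 ^ k * C)))) := by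
        rw [← Finset.sum_mul]
        congr 1
        exact_mod_cast Nat.sum_range_choose k
    _ = |τ| ^ m * ε := by field_simp

lemma main_unif (k m : ℕ) (a : ℝ → ℝ) (ha : ContDiff ℝ k a)
    (ha_bdd : ∀ i ≤ k, ∃ C : ℝ, ∀ x : ℝ, |iteratedDeriv i a x| ≤ C)
    (φ : ℝ → ℝ) (hφ : ContDiff ℝ (⊤ : ℕ∞) φ) (hφc : HasCompactSupport φ)
    (ε : ℝ) (hε : 0 < ε) :
    ∀ᶠ τ in 𝓝 (0:ℝ), ∀ x, |(FD τ 0)^[k] (fun y => a y * (FD 0 (-τ))^[m] φ y) x -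
      τ ^ (k + m) * iteratedDeriv k (fun y => a y * iteratedDeriv m φ y) x| ≤ |τ| ^ (k + m) * ε := by
  have hj : ∀ n : ℕ, ContDiff ℝ n φ := fun n => hφ.of_le (by exact_mod_cast le_top)
  have hj' : ∀ n i : ℕ, ContDiff ℝ n (iteratedDeriv i φ) :=
    fun n i => (smooth_iteratedDeriv_aux i φ hφ).of_le (by exact_mod_cast le_top)
  have hG : ContDiff ℝ k (fun y => a y * iteratedDeriv m φ y) := ha.mul (hj' k m)
  have hs : HasCompactSupport (iteratedDeriv k (fun y => a y * iteratedDeriv m φ y)) :=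
    hφc.of_isClosed_subset (isClosed_tsupport _) ((tsupport_iteratedDeriv_aux _ _).trans
      ((tsupport_mul_subset_right (f := a)).trans (tsupport_iteratedDeriv_aux _ _)))
  obtain ⟨δ, hδ, h⟩ := unif_aux _ (hG.continuous_iteratedDeriv k le_rfl) hs (ε / 2) (half_pos hε)
  have : ∀ᶠ τ in 𝓝 (0:ℝ), |τ| < δ / (k + 1) := by
    have : Tendsto (fun τ : ℝ => |τ|) (𝓝 0) (𝓝 0) := by simpa using (continuous_abs.tendsto (0:ℝ))
    exact this.eventually_lt_const (by positivity)
  filter_upwards [this, prod_unif k m a ha ha_bdd φ hφ hφc (ε / 2) (half_pos hε)] with τ hτ hP x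
  have hF : ContDiff ℝ k (fun y => a y * (FD 0 (-τ))^[m] φ y) := ha.mul (FD_iter_contDiff _ _ _ (hj k))
  have := FD_key τ 0 |τ| le_rfl (by simp) k _ hF x
    (τ ^ m * iteratedDeriv k (fun y => a y * iteratedDeriv m φ y) x) (|τ| ^ m * ε) ?_
  · calc _ = _ := by rw [sub_zero, ← mul_assoc, ← pow_add]
      _ ≤ _ := this
      _ = _ := by rw [sub_zero]; ring
  intro y hy
  have hy' : |y - x| < δ := by
    refine hy.trans_lt ?_
    rw [lt_div_iff₀ (by positivity)] at hτ
    nlinarith [abs_nonneg τ]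
  have e1 := hP y
  have e2 : iteratedDeriv k (fun y => a y *
        ((FD 0 (-τ))^[m] φ y - τ ^ m * iteratedDeriv m φ y)) y =
      iteratedDeriv k (fun y => a y * (FD 0 (-τ))^[m] φ y) y -
        τ ^ m * iteratedDeriv k (fun y => a y * iteratedDeriv m φ y) y := by
    rw [← iteratedDeriv_const_mul _ hG.contDiffAt,
      ← iteratedDeriv_fun_sub hF.contDiffAt (contDiff_const.mul hG).contDiffAt]
    congr 1
    ext z
    ring
  rw [e2] at e1
  have e3 := (h x y hy').le
  calc _ ≤ |iteratedDeriv k (fun y => a y * (FD 0 (-τ))^[m] φ y) y -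
        τ ^ m * iteratedDeriv k (fun y => a y * iteratedDeriv m φ y) y| +
        |τ ^ m * iteratedDeriv k (fun y => a y * iteratedDeriv m φ y) y -
        τ ^ m * iteratedDeriv k (fun y => a y * iteratedDeriv m φ y) x| := abs_sub_le _ _ _
    _ ≤ |τ| ^ m * (ε / 2) + |τ| ^ m * (ε / 2) := by
        refine add_le_add e1 ?_
        rw [← mul_sub, abs_mul, abs_pow]
        gcongr
    _ = _ := by ring

lemma FD_supp (p q : ℝ) (hp : |p| ≤ 1) (hq : |q| ≤ 1) (n : ℕ) (g : ℝ → ℝ) (R : ℝ)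
    (hg : ∀ x, R < |x| → g x = 0) : ∀ x, R + n < |x| → (FD p q)^[n] g x = 0 := by
  induction n with
  | zero => simpa using hg
  | succ n ih =>
    intro x hx
    push_cast at hx
    rw [Function.iterate_succ_apply']
    unfold FD
    have hh : ∀ r, |r| ≤ 1 → R + n < |x + r| := by
      intro r hr
      have : |x| ≤ |x + r| + |r| := by simpa using abs_sub (x + r) r
      linarith
    have h1 := ih (x + p) (hh p hp)
    have h2 := ih (x + q) (hh q hq)
    unfold FD at h1 h2
    rw [h1, h2, sub_zero]

lemma FD_ae (p q : ℝ) (T : H1 →L[ℂ] H1)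
    (hT : ∀ f : H1, ⇑(T f) =ᵐ[volume] fun x => f (x + p) - f (x + q))
    (f : H1) (g : ℝ → ℝ) (hf : ⇑f =ᵐ[volume] fun x => (g x : ℂ)) (n : ℕ) :
    ⇑((T ^ n) f) =ᵐ[volume] fun x => (((FD p q)^[n] g x : ℝ) : ℂ) := by
  induction n with
  | zero => simpa using hf
  | succ n ih =>
    rw [pow_succ', mul_apply_eq_comp, Function.iterate_succ_apply']
    have h1 := (quasiMeasurePreserving_add_right (volume : Measure ℝ) p).ae ih
    have h2 := (quasiMeasurePreserving_add_right (volume : Measure ℝ) q).ae ih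
    filter_upwards [hT ((T ^ n) f), h1, h2] with x e0 e1 e2
    rw [e0, e1, e2]
    simp [FD]

/-- For `k ≥ 1`, `m ≥ 0`, `a ∈ C_b^{2k}(ℝ)` and `φ ∈ C_c^∞(ℝ)`,
`(A(τ) − I)^k B_a (I − A(τ)*)^m φ = τ^{k+m} (d^k/dx^k)(a · φ^{(m)}) + o(τ^{k+m})`
in `L²(ℝ)` as `τ → 0`. -/
theorem statement7
    (k : ℕ) (hk : 1 ≤ k) (m : ℕ)
    (a : ℝ → ℝ)
    (ha : ContDiff ℝ (2 * k : ℕ) a)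
    (ha_bdd : ∀ i ≤ 2 * k, ∃ C : ℝ, ∀ x : ℝ, |iteratedDeriv i a x| ≤ C)
    (φ : ℝ → ℝ)
    (hφ : ContDiff ℝ (⊤ : ℕ∞) φ) (hφc : HasCompactSupport φ)
    (A : ℝ → (H1 →L[ℂ] H1))
    (hA : ∀ (t : ℝ) (f : H1), ⇑(A t f) =ᵐ[volume] fun x => f (x + t))
    (hAadj : ∀ (t : ℝ) (f : H1),
      ⇑((ContinuousLinearMap.adjoint (A t)) f) =ᵐ[volume] fun x => f (x - t))
    (Ba : H1 →L[ℂ] H1)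
    (hBa : ∀ f : H1, ⇑(Ba f) =ᵐ[volume] fun x => (a x : ℂ) * f x)
    -- Φ is φ viewed as an element of L²(ℝ)
    (Φ : H1) (hΦ : ⇑Φ =ᵐ[volume] fun x => (φ x : ℂ))
    -- ψ is (d^k/dx^k)(a·φ^{(m)}) viewed as an element of L²(ℝ)
    (ψ : H1) (hψ : ⇑ψ =ᵐ[volume] fun x =>
      (iteratedDeriv k (fun y => a y * iteratedDeriv m φ y) x : ℂ)) :
    Filter.Tendsto
      (fun τ : ℝ =>
        (|τ| ^ (k + m))⁻¹ *
          ‖((A τ - 1) ^ k * Ba * (1 - ContinuousLinearMap.adjoint (A τ)) ^ m) Φ -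
            ((τ ^ (k + m) : ℝ) : ℂ) • ψ‖)
      (𝓝[≠] (0 : ℝ)) (𝓝 0) := by
  have ha' : ContDiff ℝ k a := ha.of_le (by exact_mod_cast (by omega : k ≤ 2 * k))
  have hb' : ∀ i ≤ k, ∃ C : ℝ, ∀ x : ℝ, |iteratedDeriv i a x| ≤ C :=
    fun i hi => ha_bdd i (by omega)
  have hj' : ∀ n i : ℕ, ContDiff ℝ n (iteratedDeriv i φ) :=
    fun n i => (smooth_iteratedDeriv_aux i φ hφ).of_le (by exact_mod_cast le_top)
  have hG : ContDiff ℝ k (fun y => a y * iteratedDeriv m φ y) := ha'.mul (hj' k m)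
  have hψ' : ⇑ψ =ᵐ[volume] fun x =>
      ((iteratedDeriv k (fun y => a y * iteratedDeriv m φ y) x : ℝ) : ℂ) := by
    rw [← iteratedDeriv_ofReal_aux k _ hG]
    simpa using hψ
  obtain ⟨R, hR⟩ := hφc.isCompact.isBounded.subset_closedBall (0:ℝ)
  have hout : ∀ g : ℝ → ℝ, tsupport g ⊆ tsupport φ → ∀ x, R < |x| → g x = 0 := by
    intro g hg x hx
    apply image_eq_zero_of_notMem_tsupport
    intro hx'
    have := hR (hg hx')
    simp at this
    linarith
  have hGs := hout (iteratedDeriv k (fun y => a y * iteratedDeriv m φ y))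
    ((tsupport_iteratedDeriv_aux _ _).trans
      ((tsupport_mul_subset_right (f := a)).trans (tsupport_iteratedDeriv_aux _ _)))
  set s : Set ℝ := Metric.closedBall 0 (R + m + k) with hs
  have hsm : MeasurableSet s := Metric.isClosed_closedBall.measurableSet
  have hsf : volume s ≠ ⊤ := (isCompact_closedBall _ _).measure_lt_top.ne
  set M : ℝ := volume.real s ^ (1 / (2 : ℝ≥0∞).toReal) with hM
  have hM0 : 0 ≤ M := by positivity
  rw [Metric.tendsto_nhds]
  intro ε hε
  have hu := main_unif k m a ha' hb' φ hφ hφc (ε / (2 * (M + 1))) (by positivity)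
  have h1 : ∀ᶠ τ in 𝓝 (0:ℝ), |τ| < 1 := by
    have : Tendsto (fun τ : ℝ => |τ|) (𝓝 0) (𝓝 0) := by simpa using (continuous_abs.tendsto (0:ℝ))
    exact this.eventually_lt_const (by positivity)
  filter_upwards [nhdsWithin_le_nhds hu, nhdsWithin_le_nhds h1, self_mem_nhdsWithin] with τ hu h1 hτ
  have hτ0 : 0 < |τ| := abs_pos.2 hτ
  have t1 : ⇑(((1 - ContinuousLinearMap.adjoint (A τ)) ^ m) Φ) =ᵐ[volume]
      fun x => (((FD 0 (-τ))^[m] φ x : ℝ) : ℂ) := by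
    refine FD_ae 0 (-τ) _ (fun f => ?_) Φ φ hΦ m
    filter_upwards [hAadj τ f, Lp.coeFn_sub f (ContinuousLinearMap.adjoint (A τ) f)] with x e1 e2
    change (f - ContinuousLinearMap.adjoint (A τ) f : H1) x = _
    rw [e2, Pi.sub_apply, e1, add_zero, sub_eq_add_neg x τ]
  have t2 : ⇑(Ba (((1 - ContinuousLinearMap.adjoint (A τ)) ^ m) Φ)) =ᵐ[volume]
      fun x => ((a x * (FD 0 (-τ))^[m] φ x : ℝ) : ℂ) := by
    filter_upwards [hBa (((1 - ContinuousLinearMap.adjoint (A τ)) ^ m) Φ), t1] with x e1 e2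
    rw [e1, e2]; push_cast; rfl
  have t3 : ⇑(((A τ - 1) ^ k) (Ba (((1 - ContinuousLinearMap.adjoint (A τ)) ^ m) Φ))) =ᵐ[volume]
      fun x => (((FD τ 0)^[k] (fun x => a x * (FD 0 (-τ))^[m] φ x) x : ℝ) : ℂ) := by
    refine FD_ae τ 0 _ (fun f => ?_) _ _ t2 k
    filter_upwards [hA τ f, Lp.coeFn_sub (A τ f) f] with x e1 e2
    change (A τ f - f : H1) x = _
    rw [e2, Pi.sub_apply, e1, add_zero]
  have hsupp : ∀ x, R + m + k < |x| →
      (FD τ 0)^[k] (fun x => a x * (FD 0 (-τ))^[m] φ x) x = 0 := by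
    apply FD_supp τ 0 h1.le (by simp)
    intro x hx
    rw [FD_supp 0 (-τ) (by simp) (by simpa using h1.le) m φ R (hout φ le_rfl) x hx, mul_zero]
  set c : ℝ := |τ| ^ (k + m) * (ε / (2 * (M + 1))) with hc
  have hc0 : 0 ≤ c := by positivity
  have hn : ‖((A τ - 1) ^ k * Ba * (1 - ContinuousLinearMap.adjoint (A τ)) ^ m) Φ -
            ((τ ^ (k + m) : ℝ) : ℂ) • ψ‖ ≤ c * M := by
    have : c * M = ‖indicatorConstLp (E := ℝ) 2 hsm hsf c‖ := by
      rw [norm_indicatorConstLp (by norm_num) (by norm_num), Real.norm_of_nonneg hc0]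
    rw [this]
    apply Lp.norm_le_norm_of_ae_le
    simp only [mul_apply_eq_comp]
    filter_upwards [t3, hψ', Lp.coeFn_sub (((A τ - 1) ^ k) (Ba (((1 - ContinuousLinearMap.adjoint (A τ)) ^ m) Φ)))
      (((τ ^ (k + m) : ℝ) : ℂ) • ψ), Lp.coeFn_smul ((τ ^ (k + m) : ℝ) : ℂ) ψ,
      indicatorConstLp_coeFn (p := 2) (hs := hsm) (hμs := hsf) (c := c)] with x e1 e2 e3 e4 e5
    rw [e3, Pi.sub_apply, e4, Pi.smul_apply, e1, e2, e5, smul_eq_mul, ← Complex.ofReal_mul,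
      ← Complex.ofReal_sub, Complex.norm_real]
    by_cases hx : x ∈ s
    · rw [Set.indicator_of_mem hx, Real.norm_of_nonneg hc0]
      exact hu x
    · have hx' : R + m + k < |x| := by simpa [hs] using hx
      rw [Set.indicator_of_notMem hx, hsupp x hx', hGs x
        (lt_of_le_of_lt (by rw [add_assoc]; exact le_add_of_nonneg_right (by positivity)) hx')]
      simp
  rw [Real.dist_eq, sub_zero, abs_of_nonneg (by positivity)]
  calc _ ≤ (|τ| ^ (k + m))⁻¹ * (c * M) := by gcongr
    _ = ε / (2 * (M + 1)) * M := by rw [hc]; field_simp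
    _ < ε := by
      rw [div_mul_eq_mul_div, div_lt_iff₀ (by positivity)]
      nlinarith
end

section
/- Fix K ∈ ℕ. Suppose that for k = 1,…,K the functions a_k : ℝ → ℝ are bounded with bounded derivatives up to order 2k (a_k ∈ C_b^{2k}(ℝ)); that a_0 : ℝ → ℝ is measurable and locally square integrable (∫_{−R}^{R} |a_0(x)|² dx < ∞ for every R > 0); and that w : ℝ → ℝ is continuous, bounded, differentiable at zero, with w(0) = 0 and w'(0) = 1. For t ≥ 0 define F_0(t)f(x) = w(t·a_0(x))·f(x), F_k(t) = (A(t^{1/(2k)}) − I)^k ∘ B_{a_k} ∘ (I − A(t^{1/(2k)})*)^k for k = 1,…,K, and S(t) = I + ∑_{k=0}^K F_k(t). For φ ∈ C_c^∞(ℝ) define (𝓗φ)(x) = a_0(x)·φ(x) + ∑_{k=1}^{K} (d^k/dx^k)(a_k(x)·φ^{(k)}(x)). Then for every φ ∈ C_c^∞(ℝ) one has S(t)φ = φ + t·𝓗φ + o(t) in L²(ℝ) as t → 0+; explicitly, lim_{t→0+} t^{−1}·‖S(t)φ − φ − t·𝓗φ‖_{L²(ℝ)} = 0. -/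
open MeasureTheory Filter
open scoped ENNReal Topology

/-- Difference operator. -/
def TD (p q : ℝ) (g : ℝ → ℝ) : ℝ → ℝ := fun x => g (x + p) - g (x + q)

lemma TD_contDiff {n : WithTop ℕ∞} (p q : ℝ) {g : ℝ → ℝ} (hg : ContDiff ℝ n g) :
    ContDiff ℝ n (TD p q g) := by
  unfold TD
  exact (hg.comp (contDiff_id.add contDiff_const)).sub (hg.comp (contDiff_id.add contDiff_const))

lemma TD_iter_contDiff {n : WithTop ℕ∞} (p q : ℝ) (k : ℕ) : ∀ {g : ℝ → ℝ}, ContDiff ℝ n g →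
    ContDiff ℝ n ((TD p q)^[k] g) := by
  induction k with
  | zero => intro g hg; simpa using hg
  | succ k ih => intro g hg; rw [Function.iterate_succ_apply]; exact ih (TD_contDiff p q hg)

lemma iteratedDeriv_TD (p q : ℝ) (n : ℕ) {g : ℝ → ℝ} (hg : ContDiff ℝ n g) :
    iteratedDeriv n (TD p q g) = TD p q (iteratedDeriv n g) := by
  funext x
  have h1 : ContDiff ℝ n (fun z => g (z + p)) := hg.comp (contDiff_id.add contDiff_const)
  have h2 : ContDiff ℝ n (fun z => g (z + q)) := hg.comp (contDiff_id.add contDiff_const)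
  have : TD p q g = (fun z => g (z + p)) - (fun z => g (z + q)) := rfl
  rw [this, iteratedDeriv_sub h1.contDiffAt h2.contDiffAt, iteratedDeriv_comp_add_const,
    iteratedDeriv_comp_add_const]
  rfl

lemma iteratedDeriv_TD_iter (p q : ℝ) (n k : ℕ) : ∀ {g : ℝ → ℝ}, ContDiff ℝ n g →
    iteratedDeriv n ((TD p q)^[k] g) = (TD p q)^[k] (iteratedDeriv n g) := by
  induction k with
  | zero => intro g hg; rfl
  | succ k ih =>
    intro g hg
    rw [Function.iterate_succ_apply, Function.iterate_succ_apply, ih (TD_contDiff p q hg),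
      iteratedDeriv_TD p q n hg]

lemma TD_iter_mvt {p q h : ℝ} (hh : 0 < h) (hpq : p = q + h) (hp : |p| ≤ h) (hq : |q| ≤ h)
    (k : ℕ) : ∀ g : ℝ → ℝ, ContDiff ℝ k g → ∀ x, ∃ ξ, |ξ - x| ≤ k * h ∧
      (TD p q)^[k] g x = h ^ k * iteratedDeriv k g ξ := by
  induction k with
  | zero => intro g hg x; exact ⟨x, by simp⟩
  | succ k ih =>
    intro g hg x
    have hgk : ContDiff ℝ k g := hg.of_le (by exact_mod_cast Nat.le_succ k)
    obtain ⟨ξ, h1, h2⟩ := ih _ (TD_contDiff p q hgk) x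
    have hd : Differentiable ℝ (iteratedDeriv k g) :=
      hg.differentiable_iteratedDeriv k (by exact_mod_cast Nat.lt_succ_self k)
    obtain ⟨c, hc, hc'⟩ := exists_deriv_eq_slope (iteratedDeriv k g)
      (show ξ + q < ξ + p by linarith) hd.continuous.continuousOn hd.differentiableOn
    refine ⟨c, ?_, ?_⟩
    · rw [abs_le] at *
      push_cast
      constructor <;> nlinarith [hc.1, hc.2]
    · rw [Function.iterate_succ_apply, h2, iteratedDeriv_TD p q k hgk, iteratedDeriv_succ, hc']
      simp only [TD]
      have : ξ + p - (ξ + q) = h := by rw [hpq]; ring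
      rw [this]
      field_simp
      ring

/-- Leibniz polynomial. -/
noncomputable def LP (k : ℕ) (a φ : ℝ → ℝ) (ξ : ℝ) (η : ℕ → ℝ) : ℝ :=
  ∑ j ∈ Finset.range (k + 1),
    (k.choose j : ℝ) * iteratedDeriv j a ξ * iteratedDeriv (k + (k - j)) φ (η j)

lemma iteratedDeriv_add_aux (m n : ℕ) (φ : ℝ → ℝ) :
    iteratedDeriv m (iteratedDeriv n φ) = iteratedDeriv (n + m) φ := by
  rw [iteratedDeriv_eq_iterate, iteratedDeriv_eq_iterate, iteratedDeriv_eq_iterate,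
    ← Function.iterate_add_apply, add_comm]

lemma smooth_iter {φ : ℝ → ℝ} (hφ : ContDiff ℝ (⊤ : ℕ∞) φ) (n : ℕ) :
    ContDiff ℝ (⊤ : ℕ∞) (iteratedDeriv n φ) := by
  rw [iteratedDeriv_eq_iterate]
  exact hφ.iterate_deriv n

lemma LP_limit (k : ℕ) {a φ : ℝ → ℝ} (ha : ContDiff ℝ k a) (hφ : ContDiff ℝ (⊤ : ℕ∞) φ) (x : ℝ) :
    iteratedDeriv k (fun y => a y * iteratedDeriv k φ y) x = LP k a φ x (fun _ => x) := by
  have h2 : ContDiff ℝ k (iteratedDeriv k φ) :=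
    (smooth_iter hφ k).of_le (by exact_mod_cast le_top)
  have := iteratedDeriv_mul (n := k) (x := x) ha.contDiffAt h2.contDiffAt
  simp only [iteratedDeriv_add_aux] at this
  exact this

lemma key_mvt (k : ℕ) {a φ : ℝ → ℝ} (ha : ContDiff ℝ k a) (hφ : ContDiff ℝ (⊤ : ℕ∞) φ)
    (h x : ℝ) : ∃ (ξ : ℝ) (η : ℕ → ℝ), 0 < h → (|ξ - x| ≤ 2 * k * h ∧ (∀ j, |η j - x| ≤ 2 * k * h) ∧
      (TD h 0)^[k] (fun y => a y * (TD 0 (-h))^[k] φ y) x = h ^ (2 * k) * LP k a φ ξ η) := by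
  by_cases hh : 0 < h
  swap
  · exact ⟨0, 0, fun h => absurd h hh⟩
  have hfin : ∀ n : ℕ, ContDiff ℝ n φ := fun n => hφ.of_le (by exact_mod_cast le_top)
  have h2 : ContDiff ℝ k ((TD 0 (-h))^[k] φ) := TD_iter_contDiff _ _ _ (hfin k)
  obtain ⟨ξ, hξ, e⟩ := TD_iter_mvt (p := h) (q := 0) hh (by ring) (abs_of_pos hh).le (by simpa using hh.le) k _
    (ha.mul h2) x
  have hη : ∀ j : ℕ, ∃ η, |η - ξ| ≤ k * h ∧ iteratedDeriv (k - j) ((TD 0 (-h))^[k] φ) ξ =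
      h ^ k * iteratedDeriv (k + (k - j)) φ η := by
    intro j
    rw [iteratedDeriv_TD_iter _ _ _ _ (hfin _)]
    obtain ⟨η, h1, h2⟩ := TD_iter_mvt (p := 0) (q := -h) hh (by ring) (by simpa using hh.le)
      (by simp [abs_of_pos hh]) k (iteratedDeriv (k - j) φ)
      ((smooth_iter hφ _).of_le (by exact_mod_cast le_top)) ξ
    refine ⟨η, h1, ?_⟩
    rw [h2, iteratedDeriv_add_aux, add_comm]
  choose η hη1 hη2 using hη
  have hkh : 0 ≤ k * h := by positivity
  refine ⟨ξ, η, fun _ => ⟨by linarith, fun j => ?_, ?_⟩⟩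
  · have := hη1 j
    have := abs_sub_le (η j) ξ x
    linarith
  · rw [e]
    have := iteratedDeriv_mul (n := k) (x := ξ) ha.contDiffAt h2.contDiffAt
    have e2 : (fun y => a y * (TD 0 (-h))^[k] φ y) = a * (TD 0 (-h))^[k] φ := rfl
    rw [e2, this, LP, Finset.mul_sum, Finset.mul_sum]
    refine Finset.sum_congr rfl fun j _ => ?_
    rw [hη2]; ring

lemma supp_aux {φ : ℝ → ℝ} (hφ : ContDiff ℝ (⊤ : ℕ∞) φ) (hφc : HasCompactSupport φ) :
    ∃ R : ℝ, 0 < R ∧ (∀ i x, R < |x| → iteratedDeriv i φ x = 0) ∧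
      ∀ i : ℕ, ∃ C : ℝ, ∀ x, |iteratedDeriv i φ x| ≤ C := by
  obtain ⟨R, hR0, hR⟩ := hφc.isBounded.subset_closedBall_lt 0 (0 : ℝ)
  have h0 : ∀ x, R < |x| → φ x = 0 := by
    intro x hx
    by_contra h
    have := hR (subset_tsupport _ h)
    simp at this
    linarith
  have h1 : ∀ i x, R < |x| → iteratedDeriv i φ x = 0 := by
    intro i x hx
    have : φ =ᶠ[𝓝 x] fun _ => (0 : ℝ) := by
      filter_upwards [(isOpen_lt continuous_const continuous_abs).mem_nhds hx] with y hy
      exact h0 y hy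
    rw [this.iteratedDeriv_eq]
    simp
  refine ⟨R, hR0, h1, fun i => ?_⟩
  obtain ⟨C, hC⟩ := (isCompact_closedBall (0 : ℝ) R).exists_bound_of_continuousOn
    (smooth_iter hφ i).continuous.continuousOn
  refine ⟨max C 0, fun x => ?_⟩
  by_cases hx : |x| ≤ R
  · exact le_max_of_le_left (hC x (by simpa using hx))
  · rw [h1 i x (not_le.1 hx)]; simp

lemma term_k (k : ℕ) (hk : 1 ≤ k) {a φ : ℝ → ℝ} (ha : ContDiff ℝ k a)
    (hab : ∀ i ≤ k, ∃ C : ℝ, ∀ x : ℝ, |iteratedDeriv i a x| ≤ C)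
    (hφ : ContDiff ℝ (⊤ : ℕ∞) φ) (hφc : HasCompactSupport φ) (G : ℝ → ℝ → ℝ)
    (hG : ∀ t x, G t x = t⁻¹ * (TD (t ^ (1 / (2 * (k : ℝ)))) 0)^[k]
      (fun y => a y * (TD 0 (-(t ^ (1 / (2 * (k : ℝ))))))^[k] φ y) x -
      iteratedDeriv k (fun y => a y * iteratedDeriv k φ y) x) :
    (∀ x, Tendsto (fun t => G t x) (𝓝[>] 0) (𝓝 0)) ∧
    ∃ b : ℝ → ℝ, MemLp b 2 volume ∧ ∀ t ∈ Set.Ioc (0 : ℝ) 1, ∀ x, |G t x| ≤ b x := by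
  obtain ⟨R, hR0, hR, hC⟩ := supp_aux hφ hφc
  choose Cφ hCφ using hC
  have hab' : ∀ i, ∃ C : ℝ, i ≤ k → ∀ x : ℝ, |iteratedDeriv i a x| ≤ C := by
    intro i
    by_cases h : i ≤ k
    · obtain ⟨C, hC⟩ := hab i h; exact ⟨C, fun _ => hC⟩
    · exact ⟨0, fun h' => absurd h' h⟩
  choose Ca hCa using hab'
  have hk0 : (0 : ℝ) < k := by exact_mod_cast hk
  set M := ∑ j ∈ Finset.range (k + 1), (k.choose j : ℝ) * Ca j * Cφ (k + (k - j)) with hM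
  have hLP : ∀ ξ η, |LP k a φ ξ η| ≤ M := by
    intro ξ η
    refine (Finset.abs_sum_le_sum_abs _ _).trans (Finset.sum_le_sum fun j hj => ?_)
    have hj' : j ≤ k := Nat.lt_succ_iff.1 (Finset.mem_range.1 hj)
    rw [abs_mul, abs_mul, Nat.abs_cast]
    have h1 := hCa j hj' ξ
    have h2 := hCφ (k + (k - j)) (η j)
    have h3 := (abs_nonneg _).trans h1
    gcongr
  have hM0 : 0 ≤ M := (abs_nonneg _).trans (hLP 0 0)
  have hpow : ∀ t : ℝ, 0 < t → (t ^ (1 / (2 * (k : ℝ)))) ^ (2 * k) = t := by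
    intro t ht
    rw [← Real.rpow_natCast, ← Real.rpow_mul ht.le]
    push_cast
    rw [one_div, inv_mul_cancel₀ (by positivity), Real.rpow_one]
  have hGt : ∀ t x, ∃ (ξ : ℝ) (η : ℕ → ℝ), 0 < t →
      (|ξ - x| ≤ 2 * k * t ^ (1 / (2 * (k : ℝ))) ∧ (∀ j, |η j - x| ≤ 2 * k * t ^ (1 / (2 * (k : ℝ)))) ∧
      G t x = LP k a φ ξ η - LP k a φ x (fun _ => x)) := by
    intro t x
    obtain ⟨ξ, η, H⟩ := key_mvt k ha hφ (t ^ (1 / (2 * (k : ℝ)))) x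
    refine ⟨ξ, η, fun ht => ?_⟩
    obtain ⟨h1, h2, h3⟩ := H (Real.rpow_pos_of_pos ht _)
    refine ⟨h1, h2, ?_⟩
    rw [hG, h3, hpow t ht, LP_limit k ha hφ, inv_mul_cancel_left₀ ht.ne']
  choose ξ η H using hGt
  refine ⟨fun x => ?_, ?_⟩
  · have hh0 : Tendsto (fun t : ℝ => 2 * k * t ^ (1 / (2 * (k : ℝ)))) (𝓝[>] 0) (𝓝 0) := by
      have : Continuous (fun t : ℝ => 2 * k * t ^ (1 / (2 * (k : ℝ)))) :=
        continuous_const.mul (Real.continuous_rpow_const (by positivity))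
      have h := this.tendsto 0
      rw [Real.zero_rpow (by positivity), mul_zero] at h
      exact h.mono_left nhdsWithin_le_nhds
    have hξ : Tendsto (fun t => ξ t x) (𝓝[>] 0) (𝓝 x) := by
      rw [tendsto_iff_dist_tendsto_zero]
      refine squeeze_zero' (Eventually.of_forall fun _ => dist_nonneg) ?_ hh0
      filter_upwards [self_mem_nhdsWithin] with t ht
      exact (H t x ht).1
    have hη : ∀ j, Tendsto (fun t => η t x j) (𝓝[>] 0) (𝓝 x) := by
      intro j
      rw [tendsto_iff_dist_tendsto_zero]
      refine squeeze_zero' (Eventually.of_forall fun _ => dist_nonneg) ?_ hh0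
      filter_upwards [self_mem_nhdsWithin] with t ht
      exact (H t x ht).2.1 j
    have hlim : Tendsto (fun t => LP k a φ (ξ t x) (η t x)) (𝓝[>] 0)
        (𝓝 (LP k a φ x (fun _ => x))) := by
      unfold LP
      refine tendsto_finsetSum _ fun j hj => ?_
      have hj' : j ≤ k := Nat.lt_succ_iff.1 (Finset.mem_range.1 hj)
      have c1 : Continuous (iteratedDeriv j a) :=
        ha.continuous_iteratedDeriv j (by exact_mod_cast hj')
      have c2 : Continuous (iteratedDeriv (k + (k - j)) φ) := (smooth_iter hφ _).continuous
      exact (tendsto_const_nhds.mul ((c1.tendsto x).comp hξ)).mul ((c2.tendsto x).comp (hη j))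
    have := hlim.sub_const (LP k a φ x (fun _ => x))
    rw [sub_self] at this
    refine this.congr' ?_
    filter_upwards [self_mem_nhdsWithin] with t ht
    exact (H t x ht).2.2.symm
  · refine ⟨(Set.Icc (-(R + 2 * k)) (R + 2 * k)).indicator (fun _ => 2 * M),
      memLp_indicator_const 2 measurableSet_Icc _ (Or.inr (by simp)), fun t ht x => ?_⟩
    obtain ⟨h1, h2, h3⟩ := H t x ht.1
    rw [h3]
    by_cases hx : x ∈ Set.Icc (-(R + 2 * k)) (R + 2 * k)
    · rw [Set.indicator_of_mem hx]
      have := abs_sub (LP k a φ (ξ t x) (η t x)) (LP k a φ x fun _ => x)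
      linarith [hLP (ξ t x) (η t x), hLP x (fun _ => x)]
    · rw [Set.indicator_of_notMem hx]
      have hx' : R + 2 * k < |x| := by
        by_contra h
        exact hx (abs_le.1 (not_lt.1 h))
      have ht1 : t ^ (1 / (2 * (k : ℝ))) ≤ 1 := Real.rpow_le_one ht.1.le ht.2 (by positivity)
      have z1 : LP k a φ (ξ t x) (η t x) = 0 := by
        refine Finset.sum_eq_zero fun j _ => ?_
        rw [hR _ (η t x j), mul_zero]
        have := h2 j
        have h4 : |x| ≤ |η t x j| + |η t x j - x| := by
          have := abs_sub (η t x j) (η t x j - x)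
          simpa using this
        nlinarith
      have z2 : LP k a φ x (fun _ => x) = 0 := by
        refine Finset.sum_eq_zero fun j _ => ?_
        rw [hR _ x, mul_zero]
        linarith
      rw [z1, z2]; simp

lemma w_lin {w : ℝ → ℝ} (hw_bdd : ∃ C : ℝ, ∀ x : ℝ, |w x| ≤ C)
    (hw_deriv : HasDerivAt w 1 0) (hw0 : w 0 = 0) : ∃ C : ℝ, 0 ≤ C ∧ ∀ y, |w y| ≤ C * |y| := by
  obtain ⟨C, hC⟩ := hw_bdd
  have hC0 : 0 ≤ C := (abs_nonneg _).trans (hC 0)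
  have h1 := hw_deriv.isBigO_sub
  obtain ⟨c, hc⟩ := h1.bound
  obtain ⟨δ, hδ, hb⟩ := Metric.eventually_nhds_iff.1 hc
  refine ⟨max c (C / δ), le_max_of_le_right (by positivity), fun y => ?_⟩
  by_cases hy : |y| < δ
  · have := hb (y := y) (by simpa using hy)
    simp only [hw0, sub_zero, Real.norm_eq_abs] at this
    exact this.trans (by gcongr; exact le_max_left _ _)
  · have hy' := not_lt.1 hy
    calc |w y| ≤ C := hC y
      _ = C / δ * δ := by field_simp
      _ ≤ max c (C / δ) * |y| := by gcongr; exact le_max_right _ _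

lemma term_0 {φ : ℝ → ℝ} (hφ : ContDiff ℝ (⊤ : ℕ∞) φ) (hφc : HasCompactSupport φ)
    (a₀ : ℝ → ℝ) (ha₀_meas : Measurable a₀)
    (ha₀_loc : ∀ R : ℝ, 0 < R →
      IntegrableOn (fun x => (a₀ x) ^ 2) (Set.Icc (-R) R) volume)
    (w : ℝ → ℝ)
    (hw_bdd : ∃ C : ℝ, ∀ x : ℝ, |w x| ≤ C)
    (hw_deriv : HasDerivAt w 1 0)
    (hw0 : w 0 = 0) (G : ℝ → ℝ → ℝ)
    (hG : ∀ t x, G t x = t⁻¹ * (w (t * a₀ x) * φ x) - a₀ x * φ x) :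
    (∀ x, Tendsto (fun t => G t x) (𝓝[>] 0) (𝓝 0)) ∧
    ∃ b : ℝ → ℝ, MemLp b 2 volume ∧ ∀ t ∈ Set.Ioc (0 : ℝ) 1, ∀ x, |G t x| ≤ b x := by
  constructor
  · intro x
    have hd : HasDerivAt (fun t => w (t * a₀ x)) (a₀ x) 0 := by
      have h1 : HasDerivAt (fun t : ℝ => t * a₀ x) (a₀ x) 0 := by
        simpa using (hasDerivAt_id (0 : ℝ)).mul_const (a₀ x)
      have h2 : HasDerivAt w 1 ((fun t : ℝ => t * a₀ x) 0) := by simpa using hw_deriv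
      have h3 := h2.comp (0 : ℝ) h1
      rw [one_mul] at h3
      exact h3
    have hs := hd.tendsto_slope_zero_right
    simp only [zero_add, zero_mul, hw0, sub_zero, smul_eq_mul] at hs
    have := (hs.mul_const (φ x)).sub_const (a₀ x * φ x)
    rw [sub_self] at this
    refine this.congr fun t => ?_
    rw [hG]; ring
  · obtain ⟨R, hR0, hR, hC⟩ := supp_aux hφ hφc
    obtain ⟨Cφ, hCφ⟩ := hC 0
    obtain ⟨C, hC0, hw⟩ := w_lin hw_bdd hw_deriv hw0
    have hm : MemLp ((Set.Icc (-R) R).indicator a₀) 2 volume := by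
      rw [memLp_indicator_iff_restrict measurableSet_Icc,
        memLp_two_iff_integrable_sq ha₀_meas.aestronglyMeasurable]
      exact ha₀_loc R hR0
    refine ⟨fun x => ((C + 1) * Cφ) * ‖(Set.Icc (-R) R).indicator a₀ x‖,
      hm.norm.const_mul _, fun t ht x => ?_⟩
    have hφx := hCφ x
    rw [iteratedDeriv_zero] at hφx
    rw [hG]
    show _ ≤ ((C + 1) * Cφ) * ‖(Set.Icc (-R) R).indicator a₀ x‖
    by_cases hx : x ∈ Set.Icc (-R) R
    · rw [Set.indicator_of_mem hx, Real.norm_eq_abs]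
      have e : t⁻¹ * (w (t * a₀ x) * φ x) - a₀ x * φ x = (t⁻¹ * w (t * a₀ x) - a₀ x) * φ x := by ring
      have h1 : |t⁻¹ * w (t * a₀ x)| ≤ C * |a₀ x| := by
        rw [abs_mul, abs_inv, abs_of_pos ht.1, inv_mul_le_iff₀ ht.1]
        have := hw (t * a₀ x)
        rw [abs_mul, abs_of_pos ht.1] at this
        linarith
      rw [e, abs_mul]
      have h2 := abs_sub (t⁻¹ * w (t * a₀ x)) (a₀ x)
      calc _ ≤ ((C + 1) * |a₀ x|) * Cφ := by
            gcongr
            linarith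
        _ = _ := by ring
    · have hx' : R < |x| := by
        by_contra h
        exact hx (abs_le.1 (not_lt.1 h))
      have := hR 0 x hx'
      rw [iteratedDeriv_zero] at this
      rw [Set.indicator_of_notMem hx, this]; simp

lemma dct_L2 (f : ℝ → H1) (g : ℝ → ℝ → ℝ) (b : ℝ → ℝ) (hb : MemLp b 2 volume)
    (hfg : ∀ t ∈ Set.Ioc (0 : ℝ) 1, ⇑(f t) =ᵐ[volume] fun x => (g t x : ℂ))
    (hlim : ∀ x, Tendsto (fun t => g t x) (𝓝[>] 0) (𝓝 0))
    (hbd : ∀ t ∈ Set.Ioc (0 : ℝ) 1, ∀ x, |g t x| ≤ b x) :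
    Tendsto (fun t => ‖f t‖) (𝓝[>] 0) (𝓝 0) := by
  have hI : Set.Ioc (0 : ℝ) 1 ∈ 𝓝[>] (0 : ℝ) := Ioc_mem_nhdsGT one_pos
  have hn : ∀ f : H1, ‖f‖ ^ 2 = ∫ x, ‖f x‖ ^ 2 := by
    intro f
    have h := L2.inner_def (𝕜 := ℂ) f f
    have h2 : (fun x => inner ℂ (f x) (f x)) = fun x => (((‖f x‖ ^ 2 : ℝ)) : ℂ) := by
      funext x; rw [inner_self_eq_norm_sq_to_K]; norm_num
    rw [h2, integral_complex_ofReal, inner_self_eq_norm_sq_to_K] at h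
    apply Complex.ofReal_injective
    rw [← h]
    push_cast
    rfl
  have key : Tendsto (fun t => ∫ x, (g t x) ^ 2) (𝓝[>] 0) (𝓝 (∫ x : ℝ, (0 : ℝ))) := by
    refine tendsto_integral_filter_of_dominated_convergence (fun x => b x ^ 2) ?_ ?_ ?_ ?_
    · filter_upwards [hI] with t ht
      have h1 : AEStronglyMeasurable (fun x => (g t x : ℂ)) volume :=
        (Lp.aestronglyMeasurable (f t)).congr (hfg t ht)
      have h2 := (Complex.continuous_re.comp_aestronglyMeasurable h1)
      exact (h2.congr (by simp)).pow 2
    · filter_upwards [hI] with t ht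
      refine Eventually.of_forall fun x => ?_
      rw [Real.norm_eq_abs, abs_pow]
      have := hbd t ht x
      gcongr
    · exact (memLp_two_iff_integrable_sq hb.1).1 hb
    · refine Eventually.of_forall fun x => ?_
      simpa using (hlim x).pow 2
  have k2 : Tendsto (fun t => ‖f t‖ ^ 2) (𝓝[>] 0) (𝓝 0) := by
    rw [integral_zero] at key
    refine key.congr' ?_
    filter_upwards [hI] with t ht
    rw [hn]
    refine integral_congr_ae ?_
    filter_upwards [hfg t ht] with x hx
    rw [hx]; simp
  have := (Real.continuous_sqrt.tendsto 0).comp k2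
  simpa [Function.comp_def, Real.sqrt_sq] using this

lemma shift_ae {u v : ℝ → ℂ} (h : u =ᵐ[volume] v) (c : ℝ) :
    (fun x => u (x + c)) =ᵐ[volume] fun x => v (x + c) :=
  (measurePreserving_add_right (volume : Measure ℝ) c).quasiMeasurePreserving.ae_eq_comp h

lemma iter_rep (T : H1 →L[ℂ] H1) (p q : ℝ)
    (hT : ∀ f : H1, ⇑(T f) =ᵐ[volume] fun x => f (x + p) - f (x + q)) (k : ℕ) :
    ∀ (f : H1) (g : ℝ → ℝ), ⇑f =ᵐ[volume] (fun x => (g x : ℂ)) →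
      ⇑((T ^ k) f) =ᵐ[volume] fun x => (((TD p q)^[k] g x : ℝ) : ℂ) := by
  induction k with
  | zero => intro f g h; simpa using h
  | succ k ih =>
    intro f g h
    rw [pow_succ, Function.iterate_succ]
    refine ih (T f) (TD p q g) ?_
    filter_upwards [hT f, shift_ae h p, shift_ae h q] with x h1 h2 h3
    rw [h1, h2, h3]
    simp [TD]

/-- Chernoff tangency of `S(t) = I + ∑_{k=0}^K F_k(t)` to the operator
`𝓗φ = a₀·φ + ∑_{k=1}^K (d^k/dx^k)(a_k·φ^{(k)})`: for every `φ ∈ C_c^∞(ℝ)`,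
`S(t)φ = φ + t·𝓗φ + o(t)` in `L²(ℝ)` as `t → 0+`. -/
theorem statement10
    (K : ℕ)
    (a : ℕ → ℝ → ℝ)
    (ha : ∀ k ∈ Finset.Icc 1 K, ContDiff ℝ (2 * k : ℕ) (a k))
    (ha_bdd : ∀ k ∈ Finset.Icc 1 K, ∀ i ≤ 2 * k,
      ∃ C : ℝ, ∀ x : ℝ, |iteratedDeriv i (a k) x| ≤ C)
    (a₀ : ℝ → ℝ) (ha₀_meas : Measurable a₀)
    (ha₀_loc : ∀ R : ℝ, 0 < R →
      IntegrableOn (fun x => (a₀ x) ^ 2) (Set.Icc (-R) R) volume)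
    (w : ℝ → ℝ)
    (hw_cont : Continuous w)
    (hw_bdd : ∃ C : ℝ, ∀ x : ℝ, |w x| ≤ C)
    (hw_deriv : HasDerivAt w 1 0)
    (hw0 : w 0 = 0)
    (A : ℝ → (H1 →L[ℂ] H1))
    (hA : ∀ (t : ℝ) (f : H1), ⇑(A t f) =ᵐ[volume] fun x => f (x + t))
    (hAadj : ∀ (t : ℝ) (f : H1),
      ⇑((ContinuousLinearMap.adjoint (A t)) f) =ᵐ[volume] fun x => f (x - t))
    (B : ℕ → (H1 →L[ℂ] H1))
    (hB : ∀ k ∈ Finset.Icc 1 K, ∀ f : H1,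
      ⇑(B k f) =ᵐ[volume] fun x => (a k x : ℂ) * f x)
    (F : ℕ → ℝ → (H1 →L[ℂ] H1))
    (hF0 : ∀ (t : ℝ) (f : H1),
      ⇑(F 0 t f) =ᵐ[volume] fun x => (w (t * a₀ x) : ℂ) * f x)
    (hFk : ∀ k ∈ Finset.Icc 1 K, ∀ t : ℝ,
      F k t = (A (t ^ (1 / (2 * (k : ℝ)))) - 1) ^ k * B k *
        (1 - ContinuousLinearMap.adjoint (A (t ^ (1 / (2 * (k : ℝ)))))) ^ k)
    (S : ℝ → (H1 →L[ℂ] H1))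
    (hS : ∀ t : ℝ, S t = 1 + ∑ k ∈ Finset.range (K + 1), F k t)
    (φ : ℝ → ℝ)
    (hφ : ContDiff ℝ (⊤ : ℕ∞) φ) (hφc : HasCompactSupport φ)
    -- Φ is φ viewed as an element of L²(ℝ)
    (Φ : H1) (hΦ : ⇑Φ =ᵐ[volume] fun x => (φ x : ℂ))
    -- ψ is 𝓗φ viewed as an element of L²(ℝ)
    (ψ : H1) (hψ : ⇑ψ =ᵐ[volume] fun x =>
      ((a₀ x * φ x + ∑ k ∈ Finset.Icc 1 K,
        iteratedDeriv k (fun y => a k y * iteratedDeriv k φ y) x : ℝ) : ℂ)) :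
    Filter.Tendsto
      (fun t : ℝ => t⁻¹ * ‖S t Φ - Φ - ((t : ℝ) : ℂ) • ψ‖)
      (𝓝[>] (0 : ℝ)) (𝓝 0) := by
  classical
  set h : ℕ → ℝ → ℝ := fun k t => t ^ (1 / (2 * (k : ℝ))) with hh
  set D : ℕ → ℝ → ℝ → ℝ := fun k t => (TD (h k t) 0)^[k]
    (fun y => a k y * (TD 0 (-(h k t)))^[k] φ y) with hD
  -- representation of the terms
  have rep : ∀ k ∈ Finset.Icc 1 K, ∀ t, ⇑(F k t Φ) =ᵐ[volume] fun x => ((D k t x : ℝ) : ℂ) := by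
    intro k hk t
    rw [hFk k hk t]
    have r1 := iter_rep (1 - ContinuousLinearMap.adjoint (A (h k t))) 0 (-(h k t)) (by
      intro f
      have e : (1 - ContinuousLinearMap.adjoint (A (h k t))) f
          = f - ContinuousLinearMap.adjoint (A (h k t)) f := rfl
      rw [e]
      filter_upwards [Lp.coeFn_sub f (ContinuousLinearMap.adjoint (A (h k t)) f),
        hAadj (h k t) f] with x h1 h2
      rw [h1, Pi.sub_apply, h2, add_zero, sub_eq_add_neg x]) k Φ φ hΦ
    have r2 := hB k hk (((1 - ContinuousLinearMap.adjoint (A (h k t))) ^ k) Φ)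
    refine iter_rep (A (h k t) - 1) (h k t) 0 (by
      intro f
      have e : (A (h k t) - 1) f = A (h k t) f - f := rfl
      rw [e]
      filter_upwards [Lp.coeFn_sub (A (h k t) f) f, hA (h k t) f] with x h1 h2
      rw [h1, Pi.sub_apply, h2, add_zero]) k
      (B k (((1 - ContinuousLinearMap.adjoint (A (h k t))) ^ k) Φ))
      (fun y => a k y * (TD 0 (-(h k t)))^[k] φ y) ?_
    filter_upwards [r1, r2] with x h1 h2
    rw [h2, h1]
    push_cast
    rfl
  -- pointwise facts
  let G : ℕ → ℝ → ℝ → ℝ := fun k t x =>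
    if k = 0 then t⁻¹ * (w (t * a₀ x) * φ x) - a₀ x * φ x
    else t⁻¹ * D k t x - iteratedDeriv k (fun y => a k y * iteratedDeriv k φ y) x
  have hGk : ∀ k, k ∈ Finset.range (K + 1) →
      (∀ x, Tendsto (fun t => G k t x) (𝓝[>] 0) (𝓝 0)) ∧
      ∃ b : ℝ → ℝ, MemLp b 2 volume ∧ ∀ t ∈ Set.Ioc (0 : ℝ) 1, ∀ x, |G k t x| ≤ b x := by
    intro k hk
    rw [Finset.mem_range] at hk
    rcases Nat.eq_zero_or_pos k with rfl | hpos
    · exact term_0 hφ hφc a₀ ha₀_meas ha₀_loc w hw_bdd hw_deriv hw0 _ (fun t x => by simp [G])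
    · have hk' : k ∈ Finset.Icc 1 K := Finset.mem_Icc.2 ⟨hpos, by omega⟩
      refine term_k k hpos ((ha k hk').of_le (by exact_mod_cast (by omega : k ≤ 2 * k)))
        (fun i hi => ha_bdd k hk' i (by omega)) hφ hφc _ (fun t x => ?_)
      simp [G, hpos.ne', hD, hh]
  have hb' : ∀ k, ∃ b : ℝ → ℝ, k ∈ Finset.range (K + 1) → (MemLp b 2 volume ∧
      ∀ t ∈ Set.Ioc (0 : ℝ) 1, ∀ x, |G k t x| ≤ b x) := by
    intro k
    by_cases hk : k ∈ Finset.range (K + 1)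
    · obtain ⟨b, hb⟩ := (hGk k hk).2
      exact ⟨b, fun _ => hb⟩
    · exact ⟨0, fun h => absurd h hk⟩
  choose b hb using hb'
  have hrange : ∀ u : ℕ → ℂ, ∑ k ∈ Finset.range (K + 1), u k = u 0 + ∑ k ∈ Finset.Icc 1 K, u k := by
    intro u
    rw [Finset.range_eq_Ico, Finset.sum_eq_sum_Ico_succ_bot (Nat.succ_pos K)]
    rfl
  have main := dct_L2 (fun t => ((t⁻¹ : ℝ) : ℂ) • (S t Φ - Φ - ((t : ℝ) : ℂ) • ψ))
    (fun t x => ∑ k ∈ Finset.range (K + 1), G k t x)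
    (fun x => ∑ k ∈ Finset.range (K + 1), b k x)
    (memLp_finsetSum _ fun k hk => (hb k hk).1) ?_ ?_ ?_
  · refine main.congr' ?_
    filter_upwards [self_mem_nhdsWithin] with t ht
    have ht' : (0 : ℝ) < t := ht
    rw [norm_smul, Complex.norm_real, Real.norm_eq_abs, abs_of_pos (inv_pos.2 ht')]
  · intro t ht
    have ht0 : (t : ℂ) ≠ 0 := by exact_mod_cast ht.1.ne'
    have e : S t Φ - Φ - ((t : ℝ) : ℂ) • ψ
        = (∑ k ∈ Finset.range (K + 1), F k t Φ) - ((t : ℝ) : ℂ) • ψ := by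
      rw [hS t]
      simp
    have hsum : ⇑(∑ k ∈ Finset.range (K + 1), F k t Φ) =ᵐ[volume]
        fun x => ∑ k ∈ Finset.range (K + 1), (F k t Φ) x := by
      have := Lp.coeFn_finsetSum (Finset.range (K + 1)) (fun k => F k t Φ)
      filter_upwards [this] with x hx
      rw [hx, Finset.sum_apply]
    have hall : ∀ᵐ x ∂(volume : Measure ℝ), ∀ k ∈ Finset.Icc 1 K, (F k t Φ) x = ((D k t x : ℝ) : ℂ) := by
      rw [Finset.eventually_all]
      exact fun k hk => rep k hk t
    simp only [e]
    filter_upwards [Lp.coeFn_smul ((t⁻¹ : ℝ) : ℂ)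
        ((∑ k ∈ Finset.range (K + 1), F k t Φ) - ((t : ℝ) : ℂ) • ψ),
      Lp.coeFn_sub (∑ k ∈ Finset.range (K + 1), F k t Φ) (((t : ℝ) : ℂ) • ψ),
      Lp.coeFn_smul ((t : ℝ) : ℂ) ψ, hsum, hall, hψ, hF0 t Φ, hΦ] with x h1 h2 h3 h4 h5 h6 h7 h8
    rw [h1, Pi.smul_apply, h2, Pi.sub_apply, h3, Pi.smul_apply, h4, h6, hrange, h7, h8,
      Finset.sum_congr rfl h5]
    push_cast
    rw [hrange]
    have e3 : ∀ k ∈ Finset.Icc 1 K, ((G k t x : ℝ) : ℂ) = (t : ℂ)⁻¹ * ((D k t x : ℝ) : ℂ) -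
        ((iteratedDeriv k (fun y => a k y * iteratedDeriv k φ y) x : ℝ) : ℂ) := by
      intro k hk
      have : k ≠ 0 := by have := (Finset.mem_Icc.1 hk).1; omega
      simp [G, this]
    rw [Finset.sum_congr rfl e3, Finset.sum_sub_distrib, ← Finset.mul_sum]
    simp only [G, if_true, smul_eq_mul]
    push_cast
    field_simp
    ring
  · intro x
    have := tendsto_finsetSum (Finset.range (K + 1)) (fun k hk => (hGk k hk).1 x)
    simpa using this
  · intro t ht x
    exact (Finset.abs_sum_le_sum_abs _ _).trans (Finset.sum_le_sum fun k hk => (hb k hk).2 t ht x)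
end

section
/- Let d ≥ 1 be an integer, let w : ℝ → ℝ be continuous and bounded, and let V : ℝᵈ → ℝ be measurable. Then for every f ∈ L²(ℝᵈ) the map t ↦ W(t)f is continuous from [0,∞) to L²(ℝᵈ) (continuity in the L² norm). -/
open MeasureTheory Filter
open scoped ENNReal

noncomputable abbrev Hd (d : ℕ) : Type :=
  Lp ℂ 2 (volume : Measure (EuclideanSpace ℝ (Fin d)))

theorem aux_trans {d : ℕ} (f : Hd d) (v : ℝ → EuclideanSpace ℝ (Fin d)) (hv : Continuous v) :
    ∃ T : ℝ → Hd d, Continuous T ∧ ∀ t, ⇑(T t) =ᵐ[volume] fun x => f (x + v t) := by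
  let g : C(ℝ, C(EuclideanSpace ℝ (Fin d), EuclideanSpace ℝ (Fin d))) :=
    (ContinuousMap.mk (fun a : ℝ × EuclideanSpace ℝ (Fin d) => a.2 + v a.1)
      (by fun_prop)).curry
  have hg : ∀ t, MeasurePreserving (g t) (volume : Measure (EuclideanSpace ℝ (Fin d))) volume :=
    fun t => measurePreserving_add_right volume (v t)
  refine ⟨fun t => Lp.compMeasurePreserving (g t) (hg t) f,
    Continuous.compMeasurePreservingLp continuous_const g.continuous hg (by simp), fun t => ?_⟩
  exact Lp.coeFn_compMeasurePreserving f (hg t)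

theorem aux_mul {d : ℕ} (f : Hd d) (w : ℝ → ℝ) (hw_cont : Continuous w)
    (hw_bdd : ∃ C : ℝ, ∀ x : ℝ, |w x| ≤ C)
    (V : EuclideanSpace ℝ (Fin d) → ℝ) (hV : Measurable V) :
    ∃ M : ℝ → Hd d, Continuous M ∧
      ∀ t, ⇑(M t) =ᵐ[volume] fun x => (w (-t * V x) : ℂ) * f x := by
  obtain ⟨C, hC⟩ := hw_bdd
  have hmeas : ∀ t, AEStronglyMeasurable (fun x => (w (-t * V x) : ℂ) * f x)
      (volume : Measure (EuclideanSpace ℝ (Fin d))) := by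
    intro t
    refine AEStronglyMeasurable.mul ?_ (Lp.aestronglyMeasurable f)
    have h1 : Measurable fun x => w (-t * V x) := hw_cont.measurable.comp (hV.const_mul _)
    exact (Complex.measurable_ofReal.comp h1).aestronglyMeasurable
  have hmem : ∀ t, MemLp (fun x => (w (-t * V x) : ℂ) * f x) 2
      (volume : Measure (EuclideanSpace ℝ (Fin d))) := by
    intro t
    refine MemLp.of_le_mul (c := C) (Lp.memLp f) (hmeas t) (Eventually.of_forall fun x => ?_)
    rw [norm_mul, Complex.norm_real]
    exact mul_le_mul_of_nonneg_right (hC _) (norm_nonneg _)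
  refine ⟨fun t => (hmem t).toLp _, ?_, fun t => (hmem t).coeFn_toLp⟩
  rw [continuous_iff_continuousAt]
  intro t₀
  unfold ContinuousAt
  rw [Lp.tendsto_Lp_iff_tendsto_eLpNorm'']
  have hb : MemLp (fun x => ((2 * C : ℝ) : ℂ) * f x) 2
      (volume : Measure (EuclideanSpace ℝ (Fin d))) := (Lp.memLp f).const_mul _
  have hfin := lintegral_rpow_enorm_lt_top_of_eLpNorm_lt_top (by simp) (by simp) hb.2
  have key : Tendsto (fun t => ∫⁻ x, ‖(w (-t * V x) : ℂ) * f x - (w (-t₀ * V x) : ℂ) * f x‖ₑ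
      ^ (2 : ℝ≥0∞).toReal) (nhds t₀)
      (nhds (∫⁻ _x : EuclideanSpace ℝ (Fin d), 0)) := by
    refine tendsto_lintegral_filter_of_dominated_convergence' _ ?_ ?_ hfin.ne ?_
    · exact Eventually.of_forall fun t => (((hmeas t).sub (hmeas t₀)).enorm).pow_const _
    · refine Eventually.of_forall fun t => Eventually.of_forall fun x => ?_
      refine ENNReal.rpow_le_rpow ?_ (by simp)
      rw [enorm_le_iff_norm_le, ← sub_mul, norm_mul, norm_mul]
      refine mul_le_mul_of_nonneg_right ?_ (norm_nonneg _)
      rw [← Complex.ofReal_sub, Complex.norm_real, Complex.norm_real]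
      have h1 := abs_le.1 (hC (-t * V x))
      have h2 := abs_le.1 (hC (-t₀ * V x))
      refine le_trans ?_ (le_abs_self _)
      rw [Real.norm_eq_abs, abs_le]
      constructor <;> linarith
    · refine Eventually.of_forall fun x => ?_
      have hc : Continuous fun t : ℝ =>
          ‖(w (-t * V x) : ℂ) * f x - (w (-t₀ * V x) : ℂ) * f x‖ₑ ^ (2 : ℝ≥0∞).toReal := by
        refine (ENNReal.continuous_rpow_const).comp (Continuous.enorm ?_)
        fun_prop
      have := hc.tendsto t₀
      simpa using this
  rw [lintegral_zero] at key
  have := (ENNReal.continuous_rpow_const (y := 1 / (2 : ℝ≥0∞).toReal)).tendsto 0 |>.comp key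
  have h0 : (0 : ℝ≥0∞) ^ (1 / (2 : ℝ≥0∞).toReal) = 0 := by
    rw [ENNReal.zero_rpow_of_pos]; simp
  rw [h0] at this
  refine this.congr fun t => ?_
  rw [eLpNorm_eq_lintegral_rpow_enorm_toReal (by simp) (by simp)]
  rfl

/-- For `d ≥ 1`, `w` continuous and bounded, `V` measurable, and every
`f ∈ L²(ℝᵈ)`, the map `t ↦ W(t)f` is continuous from `[0,∞)` to `L²(ℝᵈ)`. -/
theorem statement14
    (d : ℕ) (hd : 1 ≤ d)
    (w : ℝ → ℝ) (hw_cont : Continuous w)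
    (hw_bdd : ∃ C : ℝ, ∀ x : ℝ, |w x| ≤ C)
    (V : EuclideanSpace ℝ (Fin d) → ℝ) (hV : Measurable V)
    (W : ℝ → (Hd d →L[ℂ] Hd d))
    (hW : ∀ (t : ℝ) (f : Hd d), ⇑(W t f) =ᵐ[volume] fun x =>
      (1 / (2 * (d : ℂ))) *
        ∑ j : Fin d,
          (f (x + (Real.sqrt d * Real.sqrt t) • EuclideanSpace.single j (1 : ℝ)) +
            f (x - (Real.sqrt d * Real.sqrt t) • EuclideanSpace.single j (1 : ℝ)) -
            2 * f x) +
        (w (-t * V x) : ℂ) * f x) :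
    ∀ f : Hd d, ContinuousOn (fun t : ℝ => W t f) (Set.Ici 0) := by
  intro f
  obtain ⟨M, hM, hM'⟩ := aux_mul f w hw_cont hw_bdd V hV
  have hv : ∀ j : Fin d, Continuous fun t : ℝ =>
      (Real.sqrt d * Real.sqrt t) • (EuclideanSpace.single j (1 : ℝ) :
        EuclideanSpace ℝ (Fin d)) := by
    intro j
    fun_prop
  choose P hP hP' using fun j => aux_trans f _ (hv j)
  choose Q hQ hQ' using fun j => aux_trans f _ (hv j).neg
  have hEq : (fun t => W t f) = fun t =>
      (1 / (2 * (d : ℂ))) • (∑ j : Fin d, (P j t + Q j t - (2 : ℂ) • f)) + M t := by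
    funext t
    refine Lp.ext ?_
    have hs : ⇑(∑ j : Fin d, (P j t + Q j t - (2 : ℂ) • f)) =ᵐ[volume]
        fun x => ∑ j : Fin d, (P j t + Q j t - (2 : ℂ) • f) x := by
      exact Lp.coeFn_fun_finsetSum Finset.univ fun j : Fin d => P j t + Q j t - (2 : ℂ) • f
    have hall : ∀ᵐ x ∂(volume : Measure (EuclideanSpace ℝ (Fin d))), ∀ j : Fin d,
        (P j t + Q j t - (2 : ℂ) • f) x =
          f (x + (Real.sqrt d * Real.sqrt t) • EuclideanSpace.single j (1 : ℝ)) +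
            f (x - (Real.sqrt d * Real.sqrt t) • EuclideanSpace.single j (1 : ℝ)) -
            2 * f x := by
      rw [ae_all_iff]
      intro j
      filter_upwards [Lp.coeFn_sub (P j t + Q j t) ((2 : ℂ) • f), Lp.coeFn_add (P j t) (Q j t),
        Lp.coeFn_smul (2 : ℂ) f, hP' j t, hQ' j t] with x h1 h2 h3 h4 h5
      rw [h1, Pi.sub_apply, h2, Pi.add_apply, h3, Pi.smul_apply, h4, h5, smul_eq_mul,
        Pi.neg_apply, ← sub_eq_add_neg]
    filter_upwards [hW t f, hs, hall, hM' t,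
      Lp.coeFn_add ((1 / (2 * (d : ℂ))) • (∑ j : Fin d, (P j t + Q j t - (2 : ℂ) • f))) (M t),
      Lp.coeFn_smul (1 / (2 * (d : ℂ))) (∑ j : Fin d, (P j t + Q j t - (2 : ℂ) • f))]
      with x h1 h2 h3 h4 h5 h6
    rw [h1, h5, Pi.add_apply, h6, Pi.smul_apply, h2, h4, smul_eq_mul,
      Finset.sum_congr rfl fun j _ => h3 j]
  rw [hEq]
  have hsum : Continuous fun t => ∑ j : Fin d, (P j t + Q j t - (2 : ℂ) • f) :=
    continuous_finset_sum _ fun j _ => ((hP j).add (hQ j)).sub continuous_const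
  exact ((hsum.const_smul (1 / (2 * (d : ℂ)))).add hM).continuousOn
end

section
/- Let d ≥ 1 be an integer and let f ∈ C_c^∞(ℝᵈ). Then (1/(2d))·∑_{j=1}^{d} [f(· + √d·√t·e_j) + f(· − √d·√t·e_j) − 2f] = (t/2)·Δf + o(t) in L²(ℝᵈ) as t → 0+; explicitly, lim_{t→0+} t^{−1} · ‖x ↦ (1/(2d))·∑_{j=1}^{d} [f(x + √d·√t·e_j) + f(x − √d·√t·e_j) − 2f(x)] − (t/2)·Δf(x)‖_{L²(ℝᵈ)} = 0, where Δf = ∑_{m=1}^{d} ∂²f/∂x_m². -/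
open MeasureTheory Filter
open scoped ENNReal Topology

lemma second_diff_bound (φ φ1 φ2 : ℝ → ℝ) (h1 : ∀ s, HasDerivAt φ (φ1 s) s)
    (h2 : ∀ s, HasDerivAt φ1 (φ2 s) s) (h L ε : ℝ) (hh : 0 ≤ h)
    (hb : ∀ s, |s| ≤ h → |φ2 s - L| ≤ ε) :
    |φ h + φ (-h) - 2 * φ 0 - h ^ 2 * L| ≤ 2 * ε * h ^ 2 := by
  have hn : ∀ s, HasDerivAt (fun s : ℝ => φ (-s)) (-(φ1 (-s))) s := by
    intro s
    exact (HasDerivAt.comp s (h1 (-s)) (hasDerivAt_neg s)).congr_deriv (by ring)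
  have hn1 : ∀ s, HasDerivAt (fun s : ℝ => φ1 (-s)) (-(φ2 (-s))) s := by
    intro s
    exact (HasDerivAt.comp s (h2 (-s)) (hasDerivAt_neg s)).congr_deriv (by ring)
  have hε : 0 ≤ ε := (abs_nonneg _).trans (hb 0 (by simpa using hh))
  have d0 : ∀ s, HasDerivAt (fun s => φ s + φ (-s) - s ^ 2 * L)
      (φ1 s - φ1 (-s) - 2 * s * L) s := by
    intro s
    exact (((h1 s).add (hn s)).sub ((hasDerivAt_pow 2 s).mul_const L)).congr_deriv
      (by norm_num; ring)
  have d1 : ∀ s, HasDerivAt (fun s => φ1 s - φ1 (-s) - 2 * s * L)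
      (φ2 s + φ2 (-s) - 2 * L) s := by
    intro s
    exact (((h2 s).sub (hn1 s)).sub (((hasDerivAt_id s).const_mul 2).mul_const L)).congr_deriv
      (by norm_num)
  have b1 : ∀ s ∈ Set.Icc 0 h, ‖φ1 s - φ1 (-s) - 2 * s * L‖ ≤ 2 * ε * h := by
    intro s hs
    have := Convex.norm_image_sub_le_of_norm_hasDerivWithin_le (C := 2 * ε)
      (fun s (_ : s ∈ Set.Icc 0 h) => (d1 s).hasDerivWithinAt) (fun s hs => by
        have a := hb s (by rw [abs_of_nonneg hs.1]; exact hs.2)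
        have b := hb (-s) (by rw [abs_neg, abs_of_nonneg hs.1]; exact hs.2)
        rw [abs_le] at a b
        rw [Real.norm_eq_abs, abs_le]
        constructor <;> linarith) (convex_Icc 0 h) (Set.left_mem_Icc.2 hh) hs
    simp only [neg_zero, sub_self, mul_zero, zero_mul, sub_zero] at this
    refine this.trans ?_
    rw [Real.norm_eq_abs, abs_of_nonneg hs.1]
    exact mul_le_mul_of_nonneg_left hs.2 (by positivity)
  have := Convex.norm_image_sub_le_of_norm_hasDerivWithin_le
      (fun s (_ : s ∈ Set.Icc 0 h) => (d0 s).hasDerivWithinAt) b1 (convex_Icc 0 h)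
      (Set.left_mem_Icc.2 hh) (Set.right_mem_Icc.2 hh)
  rw [Real.norm_eq_abs, Real.norm_eq_abs, sub_zero, abs_of_nonneg hh] at this
  convert this using 1
  · congr 1; simp only [neg_zero]; ring
  · ring

/-- For `d ≥ 1` and `f ∈ C_c^∞(ℝᵈ)`,
`(1/(2d))∑_j [f(·+√d√t e_j)+f(·−√d√t e_j)−2f] = (t/2)Δf + o(t)` in `L²(ℝᵈ)` as `t → 0+`,
where `Δf = ∑_m ∂²f/∂x_m²`. -/
theorem statement16
    (d : ℕ) (hd : 1 ≤ d)
    (f : EuclideanSpace ℝ (Fin d) → ℝ)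
    (hf : ContDiff ℝ (⊤ : ℕ∞) f) (hfc : HasCompactSupport f) :
    Filter.Tendsto
      (fun t : ℝ =>
        t⁻¹ *
          (eLpNorm
              (fun x : EuclideanSpace ℝ (Fin d) =>
                (1 / (2 * (d : ℝ))) *
                  ∑ j : Fin d,
                    (f (x + (Real.sqrt d * Real.sqrt t) • EuclideanSpace.single j (1 : ℝ)) +
                      f (x - (Real.sqrt d * Real.sqrt t) • EuclideanSpace.single j (1 : ℝ)) -
                      2 * f x) -
                (t / 2) *
                  ∑ m : Fin d,
                    fderiv ℝ (fun y => fderiv ℝ f y (EuclideanSpace.single m (1 : ℝ))) x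
                      (EuclideanSpace.single m (1 : ℝ)))
              2 volume).toReal)
      (𝓝[>] (0 : ℝ)) (𝓝 0) := by
  have hf2 : ∀ v : EuclideanSpace ℝ (Fin d), ContDiff ℝ (⊤ : ℕ∞) (fun y => fderiv ℝ f y v) :=
    fun v => (hf.fderiv_right (by simp)).clm_apply contDiff_const
  have hf3 : ∀ v : EuclideanSpace ℝ (Fin d), ContDiff ℝ (⊤ : ℕ∞)
      (fun x => fderiv ℝ (fun y => fderiv ℝ f y v) x v) :=
    fun v => ((hf2 v).fderiv_right (by simp)).clm_apply contDiff_const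
  have hts : ∀ v : EuclideanSpace ℝ (Fin d),
      tsupport (fun x => fderiv ℝ (fun y => fderiv ℝ f y v) x v) ⊆ tsupport f := fun v =>
    (tsupport_fderiv_apply_subset ℝ v).trans (tsupport_fderiv_apply_subset ℝ v)
  have huc : ∀ v : EuclideanSpace ℝ (Fin d),
      UniformContinuous (fun x => fderiv ℝ (fun y => fderiv ℝ f y v) x v) := fun v =>
    Continuous.uniformContinuous_of_tendsto_cocompact (hf3 v).continuous
      (HasCompactSupport.is_zero_at_infty
        (hfc.of_isClosed_subset (isClosed_tsupport _) (hts v)))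
  set K := Metric.cthickening 1 (tsupport f) with hK
  have hKc : IsCompact K := IsCompact.cthickening hfc
  have hfar : ∀ x y, x ∉ K → dist x y ≤ 1 → y ∉ tsupport f := by
    intro x y hx hxy hy
    exact hx (Metric.mem_cthickening_of_dist_le x y 1 _ hy hxy)
  have hd0 : (0 : ℝ) < d := by exact_mod_cast hd
  set M : ℝ := ((volume K) ^ (2 : ℝ≥0∞).toReal⁻¹).toReal with hM
  have hMfin : (volume K) ^ (2 : ℝ≥0∞).toReal⁻¹ ≠ ⊤ :=
    ENNReal.rpow_ne_top_of_nonneg (by simp) hKc.measure_lt_top.ne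
  have hM0 : 0 ≤ M := ENNReal.toReal_nonneg
  rw [Metric.tendsto_nhds]
  intro η hη
  obtain ⟨ε, hε, hεη⟩ : ∃ ε : ℝ, 0 < ε ∧ M * (ε * d) < η := by
    refine ⟨η / (2 * ((M + 1) * d)), by positivity, ?_⟩
    have : M * (η / (2 * ((M + 1) * d)) * d) = η * (M / (2 * (M + 1))) := by
      field_simp
    rw [this]
    have : M / (2 * (M + 1)) < 1 := by
      rw [div_lt_one (by positivity)]; linarith
    nlinarith
  have hδ : ∃ δ > 0, ∀ j : Fin d, ∀ x y : EuclideanSpace ℝ (Fin d), dist x y < δ →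
      dist (fderiv ℝ (fun y => fderiv ℝ f y (EuclideanSpace.single j (1 : ℝ))) x
                      (EuclideanSpace.single j (1 : ℝ)))
           (fderiv ℝ (fun y => fderiv ℝ f y (EuclideanSpace.single j (1 : ℝ))) y
                      (EuclideanSpace.single j (1 : ℝ))) < ε := by
    have : ∀ j : Fin d, ∃ δ > 0, ∀ x y : EuclideanSpace ℝ (Fin d), dist x y < δ →
      dist (fderiv ℝ (fun y => fderiv ℝ f y (EuclideanSpace.single j (1 : ℝ))) x
                      (EuclideanSpace.single j (1 : ℝ)))
           (fderiv ℝ (fun y => fderiv ℝ f y (EuclideanSpace.single j (1 : ℝ))) y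
                      (EuclideanSpace.single j (1 : ℝ))) < ε := by
      intro j
      obtain ⟨δ, h0, h⟩ := Metric.uniformContinuous_iff.1 (huc (EuclideanSpace.single j 1)) ε hε
      exact ⟨δ, h0, fun x y hxy => h hxy⟩
    choose δ h0 h using this
    have : Nonempty (Fin d) := ⟨⟨0, hd⟩⟩
    obtain ⟨i, hi⟩ := Finite.exists_min δ
    exact ⟨δ i, h0 i, fun j x y hxy => h j x y (hxy.trans_le (hi j))⟩
  obtain ⟨δ, hδ0, hδ⟩ := hδ
  have hev : ∀ᶠ t in 𝓝[>] (0 : ℝ), Real.sqrt d * Real.sqrt t < min δ 1 := by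
    have : Tendsto (fun t : ℝ => Real.sqrt d * Real.sqrt t) (𝓝[>] 0) (𝓝 0) := by
      have hc : Continuous (fun t : ℝ => Real.sqrt d * Real.sqrt t) := by fun_prop
      have := hc.tendsto 0
      simp only [Real.sqrt_zero, mul_zero] at this
      exact this.mono_left nhdsWithin_le_nhds
    exact this.eventually (gt_mem_nhds (by positivity))
  filter_upwards [hev, self_mem_nhdsWithin] with t ht ht0
  have ht0 : 0 < t := ht0
  set h := Real.sqrt d * Real.sqrt t with hh
  have hh0 : 0 ≤ h := by positivity
  have hh2 : h ^ 2 = d * t := by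
    rw [hh, mul_pow, Real.sq_sqrt hd0.le, Real.sq_sqrt ht0.le]
  have hhδ : h < δ := ht.trans_le (min_le_left _ _)
  have hh1 : h < 1 := ht.trans_le (min_le_right _ _)
  have hnorm : ∀ (j : Fin d) (s : ℝ), ‖s • EuclideanSpace.single j (1 : ℝ)‖ = |s| := by
    intro j s
    simp [norm_smul]
  set F := (fun x : EuclideanSpace ℝ (Fin d) =>
                (1 / (2 * (d : ℝ))) *
                  ∑ j : Fin d,
                    (f (x + h • EuclideanSpace.single j (1 : ℝ)) +
                      f (x - h • EuclideanSpace.single j (1 : ℝ)) -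
                      2 * f x) -
                (t / 2) *
                  ∑ m : Fin d,
                    fderiv ℝ (fun y => fderiv ℝ f y (EuclideanSpace.single m (1 : ℝ))) x
                      (EuclideanSpace.single m (1 : ℝ))) with hF
  have hsupp : Function.support F ⊆ K := by
    intro x hx
    by_contra hxK
    apply hx
    have z : ∀ y, dist x y ≤ 1 → f y = 0 := fun y hy =>
      image_eq_zero_of_notMem_tsupport (hfar x y hxK hy)
    have z2 : ∀ m : Fin d, fderiv ℝ (fun y => fderiv ℝ f y (EuclideanSpace.single m (1 : ℝ))) x
                      (EuclideanSpace.single m (1 : ℝ)) = 0 := fun m =>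
      image_eq_zero_of_notMem_tsupport
        (f := fun x => fderiv ℝ (fun y => fderiv ℝ f y (EuclideanSpace.single m (1 : ℝ))) x
                      (EuclideanSpace.single m (1 : ℝ)))
        (fun hx' => hfar x x hxK (by simp) (hts _ hx'))
    have z3 : ∀ j : Fin d, f (x + h • EuclideanSpace.single j (1 : ℝ)) = 0 := fun j =>
      z _ (by rw [dist_self_add_right, hnorm, abs_of_nonneg hh0]; exact hh1.le)
    have z4 : ∀ j : Fin d, f (x - h • EuclideanSpace.single j (1 : ℝ)) = 0 := fun j =>
      z _ (by rw [dist_self_sub_right, hnorm, abs_of_nonneg hh0]; exact hh1.le)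
    simp only [hF, z2, z3, z4, z x (by simp)]
    simp
  have hbd : ∀ x, ‖F x‖ ≤ ε * d * t := by
    intro x
    have key : ∀ j : Fin d, |f (x + h • EuclideanSpace.single j (1 : ℝ)) +
        f (x - h • EuclideanSpace.single j (1 : ℝ)) - 2 * f x -
        h ^ 2 * fderiv ℝ (fun y => fderiv ℝ f y (EuclideanSpace.single j (1 : ℝ))) x
                      (EuclideanSpace.single j (1 : ℝ))| ≤ 2 * ε * h ^ 2 := by
      intro j
      set v : EuclideanSpace ℝ (Fin d) := EuclideanSpace.single j (1 : ℝ) with hv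
      have hl : ∀ s : ℝ, HasDerivAt (fun s : ℝ => x + s • v) v s := fun s => by
        simpa using ((hasDerivAt_id s).smul_const v).const_add x
      have := second_diff_bound (fun s => f (x + s • v)) (fun s => fderiv ℝ f (x + s • v) v)
        (fun s => fderiv ℝ (fun y => fderiv ℝ f y v) (x + s • v) v)
        (fun s => ((hf.differentiable (by simp)) _).hasFDerivAt.comp_hasDerivAt s (hl s))
        (fun s => (((hf2 v).differentiable (by simp)) _).hasFDerivAt.comp_hasDerivAt s (hl s))
        h (fderiv ℝ (fun y => fderiv ℝ f y v) x v) ε hh0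
        (fun s hs => by
          rw [← Real.dist_eq]
          refine (hδ j _ _ ?_).le
          rw [dist_self_add_left, hnorm]
          exact hs.trans_lt hhδ)
      simpa [sub_eq_add_neg] using this
    have e : F x = (1 / (2 * (d : ℝ))) * ∑ j : Fin d,
        (f (x + h • EuclideanSpace.single j (1 : ℝ)) +
        f (x - h • EuclideanSpace.single j (1 : ℝ)) - 2 * f x -
        h ^ 2 * fderiv ℝ (fun y => fderiv ℝ f y (EuclideanSpace.single j (1 : ℝ))) x
                      (EuclideanSpace.single j (1 : ℝ))) := by
      simp only [hF]
      rw [Finset.sum_sub_distrib (f := fun j : Fin d => f (x + h • EuclideanSpace.single j (1 : ℝ)) +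
        f (x - h • EuclideanSpace.single j (1 : ℝ)) - 2 * f x), ← Finset.mul_sum, hh2]
      field_simp
    rw [e, norm_mul, Real.norm_of_nonneg (by positivity : 0 ≤ 1 / (2 * (d : ℝ)))]
    have : ‖∑ j : Fin d,
        (f (x + h • EuclideanSpace.single j (1 : ℝ)) +
        f (x - h • EuclideanSpace.single j (1 : ℝ)) - 2 * f x -
        h ^ 2 * fderiv ℝ (fun y => fderiv ℝ f y (EuclideanSpace.single j (1 : ℝ))) x
                      (EuclideanSpace.single j (1 : ℝ)))‖ ≤ d * (2 * ε * h ^ 2) := by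
      refine (norm_sum_le_of_le _ (fun j _ => key j)).trans ?_
      simp
    refine (mul_le_mul_of_nonneg_left this (by positivity)).trans (le_of_eq ?_)
    rw [hh2]
    field_simp
  have hLp : (eLpNorm F 2 volume).toReal ≤ M * (ε * d * t) := by
    rw [← eLpNorm_restrict_eq_of_support_subset hsupp]
    have := eLpNorm_le_of_ae_bound (p := 2) (μ := volume.restrict K) (f := F)
      (Eventually.of_forall hbd)
    rw [Measure.restrict_apply_univ] at this
    have h3 := ENNReal.toReal_mono (ENNReal.mul_ne_top hMfin ENNReal.ofReal_ne_top) this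
    rwa [ENNReal.toReal_mul, ENNReal.toReal_ofReal (by positivity)] at h3
  rw [Real.dist_eq, sub_zero, abs_of_nonneg (by positivity)]
  calc t⁻¹ * (eLpNorm F 2 volume).toReal ≤ t⁻¹ * (M * (ε * d * t)) := by gcongr
    _ = M * (ε * d) := by field_simp
    _ < η := hεη
end

section
/- Let d ≥ 1 be an integer, let w : ℝ → ℝ be continuous, bounded, differentiable at zero, with w(0) = 0 and w'(0) = 1, and let V : ℝᵈ → ℝ be measurable and locally square integrable (∫_{‖x‖≤R} V(x)² dx < ∞ for every R > 0). Then for every f ∈ C_c^∞(ℝᵈ) one has (x ↦ w(−t·V(x))·f(x)) = −t·V·f + o(t) in L²(ℝᵈ) as t → 0+; explicitly, lim_{t→0+} t^{−1} · ‖x ↦ w(−t·V(x))·f(x) + t·V(x)·f(x)‖_{L²(ℝᵈ)} = 0. -/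
open MeasureTheory Filter
open scoped ENNReal Topology

/-- For `d ≥ 1`, `w` continuous bounded with `w(0)=0`, `w'(0)=1`, and
`V ∈ L²_loc(ℝᵈ)`, for every `f ∈ C_c^∞(ℝᵈ)` one has
`(x ↦ w(−tV(x))f(x)) = −t·V·f + o(t)` in `L²(ℝᵈ)` as `t → 0+`. -/
theorem statement17
    (d : ℕ) (hd : 1 ≤ d)
    (w : ℝ → ℝ)
    (hw_cont : Continuous w)
    (hw_bdd : ∃ C : ℝ, ∀ x : ℝ, |w x| ≤ C)
    (hw_deriv : HasDerivAt w 1 0)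
    (hw0 : w 0 = 0)
    (V : EuclideanSpace ℝ (Fin d) → ℝ) (hV : Measurable V)
    (hV_loc : ∀ R : ℝ, 0 < R →
      IntegrableOn (fun x => (V x) ^ 2) (Metric.closedBall (0 : EuclideanSpace ℝ (Fin d)) R)
        volume)
    (f : EuclideanSpace ℝ (Fin d) → ℝ)
    (hf : ContDiff ℝ (⊤ : ℕ∞) f) (hfc : HasCompactSupport f) :
    Filter.Tendsto
      (fun t : ℝ =>
        t⁻¹ *
          (eLpNorm
              (fun x : EuclideanSpace ℝ (Fin d) => w (-t * V x) * f x + t * (V x * f x))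
              2 volume).toReal)
      (𝓝[>] (0 : ℝ)) (𝓝 0) := by
  obtain ⟨C, hC⟩ := hw_bdd
  have hC0 : 0 ≤ C := (abs_nonneg _).trans (hC 0)
  -- global linear bound on the remainder
  obtain ⟨K, hK0, hK⟩ : ∃ K : ℝ, 0 ≤ K ∧ ∀ y : ℝ, |w y - y| ≤ K * |y| := by
    have h1 := hw_deriv.isLittleO.def (c := 1) one_pos
    obtain ⟨δ, hδ, hb⟩ := Metric.eventually_nhds_iff.1 h1
    refine ⟨C / δ + 1, by positivity, fun y => ?_⟩
    rcases lt_or_ge |y| δ with hy | hy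
    · have := @hb y (by simpa [Real.dist_eq] using hy)
      simp [hw0] at this
      have h2 : 0 ≤ C / δ * |y| := by positivity
      linarith
    · have h2 : |w y - y| ≤ |w y| + |y| := abs_sub _ _
      have h3 : C ≤ C / δ * |y| := by
        rw [div_mul_eq_mul_div, le_div_iff₀ hδ]
        exact mul_le_mul_of_nonneg_left hy hC0
      linarith [hC y]
  have hfcont := hf.continuous
  have hloc : LocallyIntegrable (fun x => (V x) ^ 2) volume := by
    intro x
    refine ⟨Metric.closedBall 0 (‖x‖ + 1), ?_, hV_loc _ (by positivity)⟩
    refine mem_of_superset (Metric.ball_mem_nhds x one_pos) ?_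
    intro y hy
    have h1 := norm_sub_norm_le y x
    rw [Metric.mem_ball, dist_eq_norm] at hy
    rw [mem_closedBall_zero_iff]
    linarith
  have hint : Integrable (fun x => (f x) ^ 2 * (V x) ^ 2) volume := by
    have hc : HasCompactSupport (fun x => (f x) ^ 2) :=
      hfc.comp_left (g := fun y : ℝ => y ^ 2) (by simp)
    exact hloc.integrable_smul_left_of_hasCompactSupport (hfcont.pow 2) hc
  have hlim : Tendsto (fun t : ℝ => ∫⁻ x : EuclideanSpace ℝ (Fin d),
      ENNReal.ofReal ((t⁻¹ * (w (-t * V x) * f x + t * (V x * f x))) ^ 2)) (𝓝[>] (0 : ℝ))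
      (𝓝 (∫⁻ _ : EuclideanSpace ℝ (Fin d), 0)) := by
    refine tendsto_lintegral_filter_of_dominated_convergence
      (fun x => ENNReal.ofReal (K ^ 2 * ((f x) ^ 2 * (V x) ^ 2))) ?_ ?_ ?_ ?_
    · refine Eventually.of_forall fun t => ?_
      have h1 := hw_cont.measurable
      have h2 := hfcont.measurable
      fun_prop
    · filter_upwards [self_mem_nhdsWithin] with t ht
      refine Eventually.of_forall fun x => ENNReal.ofReal_le_ofReal ?_
      have ht' : 0 < t := ht
      have h1 := hK (-t * V x)
      have e1 : t⁻¹ * (w (-t * V x) * f x + t * (V x * f x))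
          = t⁻¹ * (w (-t * V x) - (-t * V x)) * f x := by ring
      have e2 : K ^ 2 * ((f x) ^ 2 * (V x) ^ 2) = (K * V x * f x) ^ 2 := by ring
      rw [e1, e2, sq_le_sq, abs_mul, abs_mul, abs_mul, abs_mul, abs_of_nonneg hK0,
        abs_of_pos (inv_pos.2 ht')]
      refine mul_le_mul_of_nonneg_right ?_ (abs_nonneg _)
      rw [abs_mul, abs_neg, abs_of_pos ht'] at h1
      rw [inv_mul_le_iff₀ ht']
      linarith
    · exact ((hint.const_mul (K ^ 2)).lintegral_lt_top).ne
    · refine Eventually.of_forall fun x => ?_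
      have hd1 : HasDerivAt (fun t : ℝ => w (-t * V x)) (-V x) 0 := by
        have h2 : HasDerivAt (fun t : ℝ => -t * V x) (-1 * V x) 0 :=
          ((hasDerivAt_id (0 : ℝ)).neg).mul_const (V x)
        have h3 : HasDerivAt w 1 ((fun t : ℝ => -t * V x) 0) := by simpa using hw_deriv
        have h4 := h3.comp (0 : ℝ) h2
        simpa [Function.comp_def] using h4
      have hs := hd1.tendsto_slope_zero_right
      simp only [zero_add, neg_zero, zero_mul, hw0, sub_zero, smul_eq_mul] at hs
      have h5 : Tendsto (fun t : ℝ => ENNReal.ofReal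
          (((t⁻¹ * w (-t * V x)) * f x + V x * f x) ^ 2)) (𝓝[>] 0)
          (𝓝 (ENNReal.ofReal ((-V x * f x + V x * f x) ^ 2))) :=
        ENNReal.tendsto_ofReal (((hs.mul_const _).add_const _).pow 2)
      have e0 : ENNReal.ofReal ((-V x * f x + V x * f x) ^ 2) = 0 := by simp
      rw [e0] at h5
      refine h5.congr' ?_
      filter_upwards [self_mem_nhdsWithin] with t ht
      have ht' : t ≠ 0 := ne_of_gt ht
      congr 2
      field_simp
  rw [lintegral_zero] at hlim
  have e0 : ((0 : ℝ≥0∞) ^ (1 / 2 : ℝ)).toReal = 0 := by simp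
  have hl3 := (ENNReal.tendsto_toReal (a := (0 : ℝ≥0∞) ^ (1 / 2 : ℝ)) (by simp)).comp
    (((ENNReal.continuous_rpow_const (y := (1 / 2 : ℝ))).tendsto 0).comp hlim)
  rw [e0] at hl3
  refine hl3.congr' ?_
  filter_upwards [self_mem_nhdsWithin] with t ht
  have ht' : 0 < t := ht
  have e1 := eLpNorm_const_smul (μ := (volume : Measure (EuclideanSpace ℝ (Fin d)))) (p := 2)
    t⁻¹ (fun x : EuclideanSpace ℝ (Fin d) => w (-t * V x) * f x + t * (V x * f x))
  have e2 := congrArg ENNReal.toReal e1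
  rw [ENNReal.toReal_mul, toReal_enorm, Real.norm_of_nonneg (inv_pos.2 ht').le] at e2
  rw [← e2, eLpNorm_eq_lintegral_rpow_enorm_toReal (by norm_num) (by norm_num)]
  simp only [Function.comp_def, ENNReal.toReal_ofNat, Pi.smul_apply, smul_eq_mul]
  congr 3
  funext x
  rw [← ofReal_norm_eq_enorm, ENNReal.ofReal_rpow_of_nonneg (norm_nonneg _) (by norm_num)]
  simp only [Real.rpow_ofNat, Real.norm_eq_abs, sq_abs]
end

section
/- Let d ≥ 1 be an integer, let w : ℝ → ℝ be continuous, bounded, differentiable at zero, with w(0) = 0 and w'(0) = 1, and let V : ℝᵈ → ℝ be measurable and locally square integrable (∫_{‖x‖≤R} V(x)² dx < ∞ for every R > 0). Define (Hf)(x) = (1/2)·Δf(x) − V(x)·f(x) for f ∈ C_c^∞(ℝᵈ). Then for every f ∈ C_c^∞(ℝᵈ) one has W(t)f = t·Hf + o(t) in L²(ℝᵈ) as t → 0+; explicitly, lim_{t→0+} t^{−1} · ‖W(t)f − t·Hf‖_{L²(ℝᵈ)} = 0. -/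
open MeasureTheory Filter
open scoped ENNReal Topology

lemma second_diff_aux {E : Type*} [NormedAddCommGroup E] [NormedSpace ℝ E]
    (f : E → ℝ) (hf : ContDiff ℝ (⊤ : ℕ∞) f) (hfc : HasCompactSupport f)
    (e : E) (he : ‖e‖ ≤ 1) :
    (∃ M : ℝ, 0 ≤ M ∧ ∀ x : E, ∀ h : ℝ, 0 < h →
      |f (x + h • e) + f (x - h • e) - 2 * f x| ≤ M * h ^ 2) ∧
    (∀ x : E, Tendsto (fun h : ℝ => (f (x + h • e) + f (x - h • e) - 2 * f x) / h ^ 2)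
      (𝓝[>] 0) (𝓝 (fderiv ℝ (fun y => fderiv ℝ f y e) x e))) := by
  have hD : ContDiff ℝ 1 (fun y => fderiv ℝ f y e) := by
    have h1 : ContDiff ℝ 1 (fderiv ℝ f) :=
      hf.fderiv_right (by
        norm_num
        exact WithTop.coe_le_coe.2 (le_top : (2 : ℕ∞) ≤ ⊤))
    exact h1.clm_apply contDiff_const
  have hDc : HasCompactSupport (fun y => fderiv ℝ f y e) := hfc.fderiv_apply ℝ e
  obtain ⟨C, hC⟩ := hD.lipschitzWith_of_hasCompactSupport hDc (by norm_num)
  have hfd : Differentiable ℝ f := hf.differentiable (by simp)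
  have hplus : ∀ (x : E) (s : ℝ), HasDerivAt (fun s : ℝ => x + s • e) e s := by
    intro x s
    simpa using ((hasDerivAt_id s).smul_const e).const_add x
  have hminus : ∀ (x : E) (s : ℝ), HasDerivAt (fun s : ℝ => x - s • e) (-e) s := by
    intro x s
    simpa using ((hasDerivAt_id s).smul_const e).const_sub x
  have hphi : ∀ (x : E) (s : ℝ),
      HasDerivAt (fun s : ℝ => f (x + s • e) + f (x - s • e) - 2 * f x)
        (fderiv ℝ f (x + s • e) e - fderiv ℝ f (x - s • e) e) s := by
    intro x s
    have h1 := (hfd (x + s • e)).hasFDerivAt.comp_hasDerivAt s (hplus x s)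
    have h2 := (hfd (x - s • e)).hasFDerivAt.comp_hasDerivAt s (hminus x s)
    have h3 := (h1.add h2).sub_const (2 * f x)
    exact h3.congr_deriv (by simp [sub_eq_add_neg])
  constructor
  · refine ⟨2 * C, by positivity, ?_⟩
    intro x h hh
    have key := (convex_Icc (0 : ℝ) h).norm_image_sub_le_of_norm_hasDerivWithin_le
      (f := fun s : ℝ => f (x + s • e) + f (x - s • e) - 2 * f x)
      (f' := fun s => fderiv ℝ f (x + s • e) e - fderiv ℝ f (x - s • e) e)
      (C := 2 * C * h) (x := 0) (y := h)
      (fun s _ => (hphi x s).hasDerivWithinAt) ?_ ⟨le_rfl, hh.le⟩ ⟨hh.le, le_rfl⟩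
    · have e0 : f (x + (0 : ℝ) • e) + f (x - (0 : ℝ) • e) - 2 * f x = 0 := by
        simp; ring
      rw [e0, sub_zero, sub_zero, Real.norm_eq_abs, Real.norm_eq_abs, abs_of_pos hh] at key
      calc _ ≤ _ := key
        _ = _ := by ring
    · intro s hs
      have := hC.dist_le_mul (x + s • e) (x - s • e)
      rw [dist_eq_norm, dist_eq_norm] at this
      refine this.trans ?_
      have e1 : x + s • e - (x - s • e) = (2 * s) • e := by
        rw [mul_smul, two_smul]; abel
      rw [e1, norm_smul, Real.norm_eq_abs, abs_of_nonneg (by linarith [hs.1])]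
      have : 2 * s * ‖e‖ ≤ 2 * h := by nlinarith [hs.1, hs.2, norm_nonneg e]
      nlinarith [C.2, mul_le_mul_of_nonneg_left this C.2]
  · intro x
    have hDd : Differentiable ℝ (fun y => fderiv ℝ f y e) := hD.differentiable (by norm_num)
    have hder : HasDerivAt (fun s : ℝ => fderiv ℝ f (x + s • e) e - fderiv ℝ f (x - s • e) e)
        (2 * fderiv ℝ (fun y => fderiv ℝ f y e) x e) 0 := by
      have h1 := HasFDerivAt.comp_hasDerivAt (f := fun s : ℝ => x + s • e) 0
        (hDd (x + (0 : ℝ) • e)).hasFDerivAt (hplus x 0)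
      have h2 := HasFDerivAt.comp_hasDerivAt (f := fun s : ℝ => x - s • e) 0
        (hDd (x - (0 : ℝ) • e)).hasFDerivAt (hminus x 0)
      have h3 := h1.sub h2
      exact h3.congr_deriv (by simp [two_mul])
    have hslope := hasDerivAt_iff_tendsto_slope.1 hder
    refine HasDerivAt.lhopital_zero_nhdsGT
      (f' := fun s => fderiv ℝ f (x + s • e) e - fderiv ℝ f (x - s • e) e)
      (g' := fun s => 2 * s) ?_ ?_ ?_ ?_ ?_ ?_
    · exact Eventually.of_forall fun s => hphi x s
    · refine Eventually.of_forall fun s => ?_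
      simpa using hasDerivAt_pow 2 s
    · filter_upwards [self_mem_nhdsWithin] with s hs
      have : (0 : ℝ) < s := hs
      positivity
    · have := (hphi x 0).continuousAt.tendsto
      have e0 : f (x + (0 : ℝ) • e) + f (x - (0 : ℝ) • e) - 2 * f x = 0 := by
        simp; ring
      simp only [e0] at this
      exact this.mono_left nhdsWithin_le_nhds
    · have : Tendsto (fun s : ℝ => s ^ 2) (𝓝 0) (𝓝 (0 ^ 2)) := (continuous_pow 2).tendsto 0
      simp only [ne_eq, OfNat.ofNat_ne_zero, not_false_eq_true, zero_pow] at this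
      exact this.mono_left nhdsWithin_le_nhds
    · have h4 := (hslope.mono_left (nhdsWithin_mono 0
        (fun s (hs : s ∈ Set.Ioi (0 : ℝ)) => ne_of_gt hs))).const_mul (1 / 2 : ℝ)
      have e2 : (1 / 2 : ℝ) * (2 * fderiv ℝ (fun y => fderiv ℝ f y e) x e)
        = fderiv ℝ (fun y => fderiv ℝ f y e) x e := by ring
      rw [e2] at h4
      refine h4.congr' ?_
      filter_upwards [self_mem_nhdsWithin] with s hs
      have : (0 : ℝ) < s := hs
      simp only [slope_def_field, zero_smul, add_zero, sub_zero, sub_self]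
      field_simp

lemma w_bound_aux (w : ℝ → ℝ) (hw_bdd : ∃ C : ℝ, ∀ x : ℝ, |w x| ≤ C)
    (hw_deriv : HasDerivAt w 1 0) (hw0 : w 0 = 0) :
    ∃ K : ℝ, 0 ≤ K ∧ ∀ s, |w s| ≤ K * |s| := by
  obtain ⟨C, hC⟩ := hw_bdd
  have hC0 : 0 ≤ C := (abs_nonneg _).trans (hC 0)
  have h1 := hw_deriv.isBigO_sub
  obtain ⟨c, hc⟩ := h1.bound
  obtain ⟨δ, hδ, hball⟩ := Metric.eventually_nhds_iff.1 hc
  refine ⟨max c (C / δ), le_max_of_le_right (by positivity), fun s => ?_⟩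
  by_cases hs : |s| < δ
  · have := hball (y := s) (by simpa [Real.dist_eq] using hs)
    simp only [hw0, sub_zero, Real.norm_eq_abs] at this
    exact this.trans (mul_le_mul_of_nonneg_right (le_max_left _ _) (abs_nonneg _))
  · push Not at hs
    calc |w s| ≤ C := hC s
      _ = C / δ * δ := by field_simp
      _ ≤ C / δ * |s| := mul_le_mul_of_nonneg_left hs (by positivity)
      _ ≤ _ := mul_le_mul_of_nonneg_right (le_max_right _ _) (abs_nonneg _)

/-- For `d ≥ 1`, `w` continuous bounded with `w(0)=0`, `w'(0)=1`,
`V ∈ L²_loc(ℝᵈ)`, `(Hf)(x) = (1/2)Δf(x) − V(x)f(x)`, and every `f ∈ C_c^∞(ℝᵈ)`,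
one has `W(t)f = t·Hf + o(t)` in `L²(ℝᵈ)` as `t → 0+`. -/
theorem statement18
    (d : ℕ) (hd : 1 ≤ d)
    (w : ℝ → ℝ)
    (hw_cont : Continuous w)
    (hw_bdd : ∃ C : ℝ, ∀ x : ℝ, |w x| ≤ C)
    (hw_deriv : HasDerivAt w 1 0)
    (hw0 : w 0 = 0)
    (V : EuclideanSpace ℝ (Fin d) → ℝ) (hV : Measurable V)
    (hV_loc : ∀ R : ℝ, 0 < R →
      IntegrableOn (fun x => (V x) ^ 2) (Metric.closedBall (0 : EuclideanSpace ℝ (Fin d)) R)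
        volume)
    (W : ℝ → (Hd d →L[ℂ] Hd d))
    (hW : ∀ (t : ℝ) (g : Hd d), ⇑(W t g) =ᵐ[volume] fun x =>
      (1 / (2 * (d : ℂ))) *
        ∑ j : Fin d,
          (g (x + (Real.sqrt d * Real.sqrt t) • EuclideanSpace.single j (1 : ℝ)) +
            g (x - (Real.sqrt d * Real.sqrt t) • EuclideanSpace.single j (1 : ℝ)) -
            2 * g x) +
        (w (-t * V x) : ℂ) * g x)
    (f : EuclideanSpace ℝ (Fin d) → ℝ)
    (hf : ContDiff ℝ (⊤ : ℕ∞) f) (hfc : HasCompactSupport f)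
    -- Φ is f viewed as an element of L²(ℝᵈ)
    (Φ : Hd d) (hΦ : ⇑Φ =ᵐ[volume] fun x => (f x : ℂ))
    -- ψ is Hf = (1/2)Δf − V·f viewed as an element of L²(ℝᵈ)
    (ψ : Hd d) (hψ : ⇑ψ =ᵐ[volume] fun x =>
      (((1 / 2 : ℝ) *
          ∑ m : Fin d,
            fderiv ℝ (fun y => fderiv ℝ f y (EuclideanSpace.single m (1 : ℝ))) x
              (EuclideanSpace.single m (1 : ℝ)) -
        V x * f x : ℝ) : ℂ)) :
    Filter.Tendsto
      (fun t : ℝ => t⁻¹ * ‖W t Φ - ((t : ℝ) : ℂ) • ψ‖)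
      (𝓝[>] (0 : ℝ)) (𝓝 0) := by
  classical
  set e : Fin d → EuclideanSpace ℝ (Fin d) := fun j => EuclideanSpace.single j (1 : ℝ) with he_def
  have he : ∀ j, ‖e j‖ ≤ 1 := fun j => by simp [he_def]
  have hd0 : (0 : ℝ) < d := by exact_mod_cast hd
  have hdC : (d : ℂ) ≠ 0 := by exact_mod_cast hd0.ne'
  obtain ⟨K, hK0, hK⟩ := w_bound_aux w hw_bdd hw_deriv hw0
  choose M hM0 hM using fun j => (second_diff_aux f hf hfc (e j) (he j)).1
  have hlim := fun j => (second_diff_aux f hf hfc (e j) (he j)).2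
  set L : Fin d → EuclideanSpace ℝ (Fin d) → ℝ := fun m x =>
    fderiv ℝ (fun y => fderiv ℝ f y (e m)) x (e m) with hL
  set D : Fin d → EuclideanSpace ℝ (Fin d) → ℝ → ℝ := fun j x h =>
    f (x + h • e j) + f (x - h • e j) - 2 * f x with hDdef
  obtain ⟨R, hR0, hR⟩ : ∃ R : ℝ, 0 < R ∧ ∀ x, R < ‖x‖ → f x = 0 := by
    obtain ⟨R, hR0, hR⟩ := hfc.isCompact.isBounded.subset_closedBall_lt 0 0
    refine ⟨R, hR0, fun x hx => ?_⟩
    by_contra h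
    have := hR (subset_tsupport f h)
    simp at this
    linarith
  obtain ⟨B, hB⟩ : ∃ B : ℝ, ∀ x, |f x| ≤ B := by
    obtain ⟨B, hB⟩ := hfc.exists_bound_of_continuous hf.continuous
    exact ⟨B, hB⟩
  have hB0 : 0 ≤ B := (abs_nonneg _).trans (hB 0)
  have hDout : ∀ j x h, 0 < h → h ≤ 1 → R + 1 < ‖x‖ → D j x h = 0 := by
    intro j x h h0 h1 hx
    have hn : ‖h • e j‖ ≤ 1 := by
      rw [norm_smul, Real.norm_eq_abs, abs_of_pos h0]
      nlinarith [he j, norm_nonneg (e j)]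
    have a1 := norm_sub_le (x + h • e j) (h • e j)
    have a2 := norm_add_le (x - h • e j) (h • e j)
    rw [add_sub_cancel_right] at a1
    rw [sub_add_cancel] at a2
    simp only [hDdef]
    rw [hR _ (by linarith), hR _ (by linarith), hR x (by linarith)]
    ring
  have hLb : ∀ j x, |L j x| ≤ M j := by
    intro j x
    refine le_of_tendsto (hlim j x).abs ?_
    filter_upwards [self_mem_nhdsWithin] with h hh
    have hh' : (0 : ℝ) < h := hh
    rw [abs_div, abs_of_pos (by positivity : 0 < h ^ 2), div_le_iff₀ (by positivity)]
    exact hM j x h hh'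
  have hLout : ∀ j x, R + 1 < ‖x‖ → L j x = 0 := by
    intro j x hx
    refine tendsto_nhds_unique (hlim j x) (tendsto_const_nhds.congr' ?_)
    filter_upwards [Ioc_mem_nhdsGT (zero_lt_one' ℝ)] with h hh
    have := hDout j x h hh.1 hh.2 hx
    simp only [hDdef] at this
    rw [this, zero_div]
  set r : ℝ → ℝ := fun t => Real.sqrt d * Real.sqrt t with hr
  have hr2 : ∀ t, 0 < t → r t ^ 2 = d * t := by
    intro t ht
    simp only [hr]
    rw [mul_pow, Real.sq_sqrt hd0.le, Real.sq_sqrt ht.le]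
  have hrpos : ∀ t, 0 < t → 0 < r t := fun t ht => by simp only [hr]; positivity
  have hrlim : Tendsto r (𝓝[>] 0) (𝓝[>] 0) := by
    refine tendsto_nhdsWithin_iff.2 ⟨?_, ?_⟩
    · have : Continuous r := by simp only [hr]; fun_prop
      have h0 := this.tendsto 0
      simp only [hr, Real.sqrt_zero, mul_zero] at h0
      exact h0.mono_left nhdsWithin_le_nhds
    · filter_upwards [self_mem_nhdsWithin] with t ht
      exact hrpos t ht
  set F : ℝ → EuclideanSpace ℝ (Fin d) → ℝ := fun t x =>
    (∑ j, ((1 / 2) * (D j x (r t) / r t ^ 2) - (1 / 2) * L j x)) +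
      (t⁻¹ * w (-t * V x) + V x) * f x with hF
  have hae : ∀ t, 0 < t →
      ⇑(((t⁻¹ : ℝ) : ℂ) • (W t Φ - ((t : ℝ) : ℂ) • ψ)) =ᵐ[volume] fun x => ((F t x : ℝ) : ℂ) := by
    intro t ht
    have hp : ∀ j : Fin d, ∀ᵐ x, Φ (x + r t • e j) = (f (x + r t • e j) : ℂ) := fun j =>
      (measurePreserving_add_right volume (r t • e j)).quasiMeasurePreserving.ae hΦ
    have hm : ∀ j : Fin d, ∀ᵐ x, Φ (x - r t • e j) = (f (x - r t • e j) : ℂ) := fun j =>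
      (measurePreserving_sub_right volume (r t • e j)).quasiMeasurePreserving.ae hΦ
    filter_upwards [Lp.coeFn_smul (((t⁻¹ : ℝ) : ℂ)) (W t Φ - ((t : ℝ) : ℂ) • ψ),
      Lp.coeFn_sub (W t Φ) (((t : ℝ) : ℂ) • ψ), Lp.coeFn_smul ((t : ℝ) : ℂ) ψ,
      hW t Φ, hψ, hΦ, ae_all_iff.2 hp, ae_all_iff.2 hm] with x h1 h2 h3 h4 h5 h6 h7 h8
    rw [h1, Pi.smul_apply, h2, Pi.sub_apply, h3, Pi.smul_apply, h4, h5, h6]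
    have hs : (∑ j : Fin d,
          (Φ (x + (Real.sqrt d * Real.sqrt t) • EuclideanSpace.single j (1 : ℝ)) +
            Φ (x - (Real.sqrt d * Real.sqrt t) • EuclideanSpace.single j (1 : ℝ)) -
            2 * (f x : ℂ))) = ((∑ j, D j x (r t) : ℝ) : ℂ) := by
      rw [Complex.ofReal_sum]
      refine Finset.sum_congr rfl fun j _ => ?_
      have a := h7 j
      have b := h8 j
      simp only [hr, he_def] at a b
      rw [a, b]
      simp only [hDdef, hr, he_def]
      push_cast
      ring
    rw [hs]
    have hreal : F t x = t⁻¹ * ((1 / (2 * (d : ℝ))) * (∑ j, D j x (r t)) + w (-t * V x) * f x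
        - t * ((1 / 2 : ℝ) * ∑ m, L m x - V x * f x)) := by
      simp only [hF]
      rw [hr2 t ht, Finset.sum_sub_distrib, ← Finset.mul_sum, ← Finset.mul_sum,
        ← Finset.sum_div]
      field_simp
      ring
    rw [hreal]
    simp only [smul_eq_mul]
    push_cast
    rfl
  have hnorm : ∀ t, 0 < t →
      (t⁻¹ * ‖W t Φ - ((t : ℝ) : ℂ) • ψ‖) = Real.sqrt (∫ x, (F t x) ^ 2) := by
    intro t ht
    have h1 : t⁻¹ * ‖W t Φ - ((t : ℝ) : ℂ) • ψ‖
        = ‖((t⁻¹ : ℝ) : ℂ) • (W t Φ - ((t : ℝ) : ℂ) • ψ)‖ := by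
      rw [norm_smul, Complex.norm_real, Real.norm_eq_abs, abs_of_pos (inv_pos.2 ht)]
    rw [h1]
    have h2 := @L2.inner_def _ ℂ ℂ _ _ volume _ _
      (((t⁻¹ : ℝ) : ℂ) • (W t Φ - ((t : ℝ) : ℂ) • ψ))
      (((t⁻¹ : ℝ) : ℂ) • (W t Φ - ((t : ℝ) : ℂ) • ψ))
    rw [inner_self_eq_norm_sq_to_K] at h2
    have h3 : (∫ x, inner ℂ ((((t⁻¹ : ℝ) : ℂ) • (W t Φ - ((t : ℝ) : ℂ) • ψ) : Hd d) x)
        ((((t⁻¹ : ℝ) : ℂ) • (W t Φ - ((t : ℝ) : ℂ) • ψ) : Hd d) x))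
        = ((∫ x, (F t x) ^ 2 : ℝ) : ℂ) := by
      rw [← integral_complex_ofReal]
      refine integral_congr_ae ?_
      filter_upwards [hae t ht] with x hx
      rw [hx, inner_self_eq_norm_sq_to_K, Complex.norm_real, Real.norm_eq_abs]
      simp only [Complex.coe_algebraMap]
      rw [← Complex.ofReal_pow, sq_abs]
    rw [h3] at h2
    have h4 : ‖((t⁻¹ : ℝ) : ℂ) • (W t Φ - ((t : ℝ) : ℂ) • ψ)‖ ^ 2 = ∫ x, (F t x) ^ 2 := by
      simp only [Complex.coe_algebraMap] at h2
      exact_mod_cast h2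
    rw [← h4, Real.sqrt_sq (norm_nonneg _)]
  have hmeas : ∀ t, 0 < t → AEStronglyMeasurable (fun x => (F t x) ^ 2) volume := by
    intro t ht
    have h1 := (Lp.aestronglyMeasurable
      (((t⁻¹ : ℝ) : ℂ) • (W t Φ - ((t : ℝ) : ℂ) • ψ))).congr (hae t ht)
    have h2 := Complex.continuous_re.comp_aestronglyMeasurable h1
    simp only [Complex.ofReal_re] at h2
    exact h2.pow 2
  set A : ℝ := ∑ j, M j with hA
  set Q : ℝ := (K + 1) * B with hQ
  set G : EuclideanSpace ℝ (Fin d) → ℝ :=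
    (Metric.closedBall (0 : EuclideanSpace ℝ (Fin d)) (R + 1)).indicator
      (fun x => 2 * A ^ 2 + 2 * Q ^ 2 * V x ^ 2) with hG
  have hGint : Integrable G volume := by
    rw [hG, integrable_indicator_iff Metric.isClosed_closedBall.measurableSet]
    refine Integrable.add ?_ ((hV_loc (R + 1) (by linarith)).const_mul (2 * Q ^ 2))
    exact integrableOn_const (isCompact_closedBall _ _).measure_lt_top.ne
  have hbound : ∀ t, 0 < t → r t ≤ 1 → ∀ x, ‖(F t x) ^ 2‖ ≤ G x := by
    intro t ht hrt x
    rw [Real.norm_eq_abs, abs_of_nonneg (sq_nonneg _)]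
    by_cases hx : x ∈ Metric.closedBall (0 : EuclideanSpace ℝ (Fin d)) (R + 1)
    · rw [hG, Set.indicator_of_mem hx]
      have b1 : |∑ j, ((1 / 2) * (D j x (r t) / r t ^ 2) - (1 / 2) * L j x)| ≤ A := by
        refine (Finset.abs_sum_le_sum_abs _ _).trans (Finset.sum_le_sum fun j _ => ?_)
        have c1 : |D j x (r t) / r t ^ 2| ≤ M j := by
          have := hrpos t ht
          rw [abs_div, abs_of_pos (by positivity : 0 < r t ^ 2), div_le_iff₀ (by positivity)]
          exact hM j x _ this
        have c2 := hLb j x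
        rw [abs_le] at c1 c2 ⊢
        constructor <;> linarith [c1.1, c1.2, c2.1, c2.2]
      have b2 : |(t⁻¹ * w (-t * V x) + V x) * f x| ≤ Q * |V x| := by
        have c1 : |t⁻¹ * w (-t * V x)| ≤ K * |V x| := by
          rw [abs_mul, abs_of_pos (inv_pos.2 ht)]
          have := hK (-t * V x)
          rw [abs_mul, abs_neg, abs_of_pos ht] at this
          calc t⁻¹ * |w (-t * V x)| ≤ t⁻¹ * (K * (t * |V x|)) :=
                mul_le_mul_of_nonneg_left this (inv_pos.2 ht).le
            _ = _ := by field_simp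
        have c2 : |t⁻¹ * w (-t * V x) + V x| ≤ (K + 1) * |V x| := by
          have := abs_add_le (t⁻¹ * w (-t * V x)) (V x)
          linarith
        rw [abs_mul]
        calc _ ≤ ((K + 1) * |V x|) * B :=
              mul_le_mul c2 (hB x) (abs_nonneg _) (by positivity)
          _ = _ := by rw [hQ]; ring
      have b3 : |F t x| ≤ A + Q * |V x| := (abs_add_le _ _).trans (add_le_add b1 b2)
      have b4 : F t x ^ 2 ≤ (A + Q * |V x|) ^ 2 := by
        rw [← sq_abs (F t x)]
        exact pow_le_pow_left₀ (abs_nonneg _) b3 2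
      have b5 : |V x| ^ 2 = V x ^ 2 := sq_abs _
      calc _ ≤ _ := b4
        _ ≤ 2 * A ^ 2 + 2 * Q ^ 2 * |V x| ^ 2 := by nlinarith [sq_nonneg (A - Q * |V x|)]
        _ = _ := by rw [b5]
    · rw [hG, Set.indicator_of_notMem hx]
      have hx' : R + 1 < ‖x‖ := by simpa using hx
      have : F t x = 0 := by
        simp only [hF]
        rw [hR x (by linarith), mul_zero, add_zero]
        refine Finset.sum_eq_zero fun j _ => ?_
        rw [hDout j x _ (hrpos t ht) hrt hx', hLout j x hx']
        ring
      rw [this]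
      norm_num
  have hpt : ∀ x, Tendsto (fun t => (F t x) ^ 2) (𝓝[>] 0) (𝓝 0) := by
    intro x
    have p1 : Tendsto (fun t => ∑ j, ((1 / 2) * (D j x (r t) / r t ^ 2) - (1 / 2) * L j x))
        (𝓝[>] 0) (𝓝 (∑ j : Fin d, ((1 / 2) * L j x - (1 / 2) * L j x))) := by
      refine tendsto_finsetSum _ fun j _ => ?_
      exact (((hlim j x).comp hrlim).const_mul (1 / 2)).sub_const _
    have p2 : Tendsto (fun t : ℝ => t⁻¹ * w (-t * V x)) (𝓝[>] 0) (𝓝 (-V x)) := by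
      have q1 : HasDerivAt (fun t : ℝ => -t * V x) (-V x) 0 := by
        simpa using ((hasDerivAt_id (0 : ℝ)).neg.mul_const (V x))
      have q2 : HasDerivAt (fun t : ℝ => w (-t * V x)) (1 * -V x) 0 := by
        refine HasDerivAt.comp (h₂ := w) (h := fun t : ℝ => -t * V x) 0 ?_ q1
        simpa using hw_deriv
      rw [one_mul] at q2
      have q3 := (hasDerivAt_iff_tendsto_slope.1 q2).mono_left (nhdsWithin_mono 0
        (fun s (hs : s ∈ Set.Ioi (0 : ℝ)) => ne_of_gt hs))
      refine q3.congr fun t => ?_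
      simp only [slope_def_field, neg_zero, zero_mul, hw0, sub_zero]
      ring
    have p3 := (p1.add ((p2.add_const (V x)).mul_const (f x))).pow 2
    have p4 : (∑ j : Fin d, ((1 / 2) * L j x - (1 / 2) * L j x) +
        (-V x + V x) * f x) ^ 2 = 0 := by simp
    rw [p4] at p3
    exact p3
  have hint : Tendsto (fun t => ∫ x, (F t x) ^ 2) (𝓝[>] 0)
      (𝓝 (∫ _ : EuclideanSpace ℝ (Fin d), (0 : ℝ))) := by
    refine tendsto_integral_filter_of_dominated_convergence G ?_ ?_ hGint ?_
    · filter_upwards [self_mem_nhdsWithin] with t ht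
      exact hmeas t ht
    · filter_upwards [self_mem_nhdsWithin,
        hrlim.eventually (Ioc_mem_nhdsGT (zero_lt_one' ℝ))] with t ht hrt
      exact Eventually.of_forall (hbound t ht hrt.2)
    · exact Eventually.of_forall hpt
  rw [integral_zero] at hint
  have hfin := (Real.continuous_sqrt.tendsto 0).comp hint
  rw [Real.sqrt_zero] at hfin
  refine hfin.congr' ?_
  filter_upwards [self_mem_nhdsWithin] with t ht
  exact (hnorm t ht).symm
end
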